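/- arXiv:0812.1256 — 3 statements merged into one kernel-verified Lean document; each statement's English description precedes it below -/
import Mathlib

section
/- Let J be a j_2-set whose two largest elements are n - k and n (with k ≥ 1), and let m ≥ 1. Then J ∪ {n + m} is a j_2-set if and only if m = 1 or m ≥ k. -/
open Finset

namespace QT

/-- The major index of a permutation of `Fin n` (sum of descents,
with positions written `1,...,n-1` as in one-line notation). -/
def maj {n : ℕ} (π : Equiv.Perm (Fin n)) : ℕ :=
  ∑ i ∈ Finset.range n,
    if h : i + 1 < n then
      (if π ⟨i + 1, h⟩ < π ⟨i, by omega⟩ then i + 1 else 0)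
    else 0

/-- `imaj π = maj π⁻¹`. -/
def imaj {n : ℕ} (π : Equiv.Perm (Fin n)) : ℕ := maj π⁻¹

/-- The permutation of `Fin k` order-isomorphic to the word `v 0, v 1, ..., v (k-1)`. -/
noncomputable def standardize {n k : ℕ} (v : Fin k → Fin n) (hv : Function.Injective v) :
    Equiv.Perm (Fin k) :=
  Equiv.ofBijective
    (fun i => (Finset.orderIsoOfFin (Finset.image v Finset.univ)
        (by rw [Finset.card_image_of_injective _ hv, Finset.card_univ, Fintype.card_fin])).symm
        ⟨v i, Finset.mem_image_of_mem v (Finset.mem_univ i)⟩)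
    (Finite.injective_iff_bijective.mp (fun i j hij => by
      have h2 := (Finset.orderIsoOfFin _ _).symm.injective hij
      exact hv (congrArg Subtype.val h2)))

/-- `π^{≤k}` : the permutation of `Fin k` order-isomorphic to the first `k` letters of `π`. -/
noncomputable def pInit {n : ℕ} (π : Equiv.Perm (Fin n)) (k : ℕ) (hk : k ≤ n) :
    Equiv.Perm (Fin k) :=
  standardize (fun i => π (Fin.castLE hk i))
    (fun i j h => Fin.castLE_injective hk (π.injective h))

/-- `π^{>k}` : the permutation of `Fin (n-k)` order-isomorphic to the last `n - k` letters of `π`. -/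
noncomputable def pTail {n : ℕ} (π : Equiv.Perm (Fin n)) (k : ℕ) :
    Equiv.Perm (Fin (n - k)) :=
  standardize (fun i => π ⟨k + (i : ℕ), by have := i.isLt; omega⟩)
    (fun i j h => by
      have h2 : k + (i : ℕ) = k + (j : ℕ) := congrArg Fin.val (π.injective h)
      exact Fin.ext (by omega))

/-- `π_{≤k}` : the permutation of `Fin k` order-isomorphic to the subword of `π`
consisting of the `k` smallest values.  (Equivalently `((π⁻¹)^{≤k})⁻¹`.) -/
noncomputable def vLow {n : ℕ} (π : Equiv.Perm (Fin n)) (k : ℕ) (hk : k ≤ n) :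
    Equiv.Perm (Fin k) := (pInit π⁻¹ k hk)⁻¹

/-- `π_{>k}` : the permutation of `Fin (n-k)` order-isomorphic to the subword of `π`
consisting of the values `> k`.  (Equivalently `((π⁻¹)^{>k})⁻¹`.) -/
noncomputable def vHigh {n : ℕ} (π : Equiv.Perm (Fin n)) (k : ℕ) :
    Equiv.Perm (Fin (n - k)) := (pTail π⁻¹ k)⁻¹

/-- The set `I_n` of involutions in `S_n`. -/
def involutions (n : ℕ) : Finset (Equiv.Perm (Fin n)) :=
  Finset.univ.filter fun π => π * π = 1

-- `I_n(σ) = {π ∈ I_n : π_{≤m} = σ}`.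
open scoped Classical in
noncomputable def involutionsC (n : ℕ) {m : ℕ} (σ : Equiv.Perm (Fin m)) :
    Finset (Equiv.Perm (Fin n)) :=
  (involutions n).filter fun π => ∃ h : m ≤ n, vLow π m h = σ

-- `S_n(σ,τ) = {π ∈ S_n : π_{≤a} = σ, π^{≤b} = τ}`.
open scoped Classical in
noncomputable def permsC (n : ℕ) {a b : ℕ} (σ : Equiv.Perm (Fin a)) (τ : Equiv.Perm (Fin b)) :
    Finset (Equiv.Perm (Fin n)) :=
  Finset.univ.filter fun π => ∃ (ha : a ≤ n) (hb : b ≤ n), vLow π a ha = σ ∧ pInit π b hb = τ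

-- The j-set `J(σ) = {j : σ^{≤j} is an involution}`.
open scoped Classical in
noncomputable def jSet {m : ℕ} (σ : Equiv.Perm (Fin m)) : Finset ℕ :=
  (Finset.range (m + 1)).filter fun j => ∃ h : j ≤ m, pInit σ j h * pInit σ j h = 1

-- The j₂-set `J(σ,τ) = {j : σ^{≤j} = τ_{≤j}}`.
open scoped Classical in
noncomputable def j2Set {a b : ℕ} (σ : Equiv.Perm (Fin a)) (τ : Equiv.Perm (Fin b)) :
    Finset ℕ :=
  (Finset.range (min a b + 1)).filter fun j =>
    ∃ (ha : j ≤ a) (hb : j ≤ b), pInit σ j ha = vLow τ j hb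

/-- A set of nonnegative integers is a j₂-set if it is `J(σ,τ)` for some pair of
permutations. -/
def IsJ2Set (S : Finset ℕ) : Prop :=
  ∃ (a b : ℕ) (σ : Equiv.Perm (Fin a)) (τ : Equiv.Perm (Fin b)), S = j2Set σ τ

-- The number of j₂-sets with largest element `n`.
open scoped Classical in
noncomputable def j2count (n : ℕ) : ℕ :=
  ((Finset.range (n + 1)).powerset.filter
    fun S => IsJ2Set S ∧ n ∈ S ∧ ∀ x ∈ S, x ≤ n).card

/-- `[n]_q = 1 + q + ⋯ + q^{n-1}`. -/
def qInt (q : ℝ) (n : ℕ) : ℝ := ∑ i ∈ Finset.range n, q ^ i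

/-- The q-factorial `[n]_q! = ∏_{i=1}^n (1 + q + ⋯ + q^{i-1})`. -/
def qFact (q : ℝ) (n : ℕ) : ℝ := ∏ i ∈ Finset.range n, qInt q (i + 1)

/-- The Gaussian binomial coefficient `[n choose k]_q = [n]_q!/([k]_q! [n-k]_q!)`,
defined via the q-Pascal recursion. -/
def qBinom (q : ℝ) : ℕ → ℕ → ℝ
  | _, 0 => 1
  | 0, _ + 1 => 0
  | n + 1, k + 1 => qBinom q n k + q ^ (k + 1) * qBinom q n (k + 1)

/-- `t_n(q) = Σ_{π ∈ I_n} q^{maj π}`. -/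
noncomputable def tq (q : ℝ) (n : ℕ) : ℝ := ∑ π ∈ involutions n, q ^ maj π

/-- `A_n(p,q) = Σ_{π ∈ S_n} p^{imaj π} q^{maj π}`. -/
noncomputable def Apq (p q : ℝ) (n : ℕ) : ℝ :=
  ∑ π : Equiv.Perm (Fin n), p ^ imaj π * q ^ maj π


/-- `f` restricts to a bijection from `S` onto `T` preserving the order of both coordinates. -/
def IsSim (f : ℕ × ℕ → ℕ × ℕ) (S T : Finset (ℕ × ℕ)) : Prop :=
  Set.BijOn f S T ∧ ∀ p ∈ S, ∀ q ∈ S,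
    (p.1 < q.1 ↔ (f p).1 < (f q).1) ∧ (p.2 < q.2 ↔ (f p).2 < (f q).2)

/-- Two finite sets of points are order-isomorphic in both coordinates simultaneously. -/
def Sim (S T : Finset (ℕ × ℕ)) : Prop := ∃ f, IsSim f S T

theorem IsSim.mem {f : ℕ × ℕ → ℕ × ℕ} {S T : Finset (ℕ × ℕ)} (h : IsSim f S T)
    {p : ℕ × ℕ} (hp : p ∈ S) : f p ∈ T := h.1.mapsTo hp

theorem IsSim.exists_preimage {f : ℕ × ℕ → ℕ × ℕ} {S T : Finset (ℕ × ℕ)} (h : IsSim f S T)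
    {q : ℕ × ℕ} (hq : q ∈ T) : ∃ p ∈ S, f p = q := h.1.surjOn hq

theorem Sim.refl (S : Finset (ℕ × ℕ)) : Sim S S :=
  ⟨id, Set.bijOn_id _, fun _ _ _ _ => ⟨Iff.rfl, Iff.rfl⟩⟩

theorem Sim.trans {S T U : Finset (ℕ × ℕ)} : Sim S T → Sim T U → Sim S U := by
  rintro ⟨f, hf⟩ ⟨g, hg⟩
  refine ⟨g ∘ f, hg.1.comp hf.1, fun p hp q hq => ?_⟩
  have h1 := hf.2 p hp q hq
  have h2 := hg.2 _ (hf.mem hp) _ (hf.mem hq)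
  exact ⟨h1.1.trans h2.1, h1.2.trans h2.2⟩

theorem IsSim.exists_inverse {f : ℕ × ℕ → ℕ × ℕ} {S T : Finset (ℕ × ℕ)} (h : IsSim f S T) :
    ∃ g, IsSim g T S ∧ (∀ p ∈ S, g (f p) = p) ∧ ∀ q ∈ T, f (g q) = q := by
  have hinv := h.1.invOn_invFunOn
  set g := Function.invFunOn f (S : Set (ℕ × ℕ))
  have hb : Set.BijOn g T S := (Set.bijOn_comm hinv).2 h.1
  refine ⟨g, ⟨hb, fun p hp q hq => ?_⟩, fun p hp => hinv.1 hp, fun q hq => hinv.2 hq⟩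
  have h1 := h.2 _ (hb.mapsTo hp) _ (hb.mapsTo hq)
  rw [hinv.2 hp, hinv.2 hq] at h1
  exact ⟨h1.1.symm, h1.2.symm⟩

theorem Sim.symm {S T : Finset (ℕ × ℕ)} : Sim S T → Sim T S := by
  rintro ⟨f, hf⟩
  obtain ⟨g, hg, -⟩ := hf.exists_inverse
  exact ⟨g, hg⟩

/-- `S'` is an initial segment of `S` for the preorder given by the coordinate `c`. -/
def IsInitial (c : ℕ × ℕ → ℕ) (S' S : Finset (ℕ × ℕ)) : Prop :=
  S' ⊆ S ∧ ∀ p ∈ S', ∀ q ∈ S, c q ≤ c p → q ∈ S'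

theorem IsInitial.eq_of_card {c : ℕ × ℕ → ℕ} {A B S : Finset (ℕ × ℕ)}
    (hA : IsInitial c A S) (hB : IsInitial c B S) (h : A.card = B.card) : A = B := by
  by_cases hAB : A ⊆ B
  · exact Finset.eq_of_subset_of_card_le hAB h.ge
  · obtain ⟨u, huA, huB⟩ := Finset.not_subset.1 hAB
    refine (Finset.eq_of_subset_of_card_le (fun v hv => ?_) h.le).symm
    rcases le_total (c u) (c v) with huv | huv
    · exact absurd (hB.2 v hv u (hA.1 huA) huv) huB
    · exact hA.2 u huA v (hB.1 hv) huv

theorem IsSim.restrict {c f} {S T S' T' : Finset (ℕ × ℕ)} (h : IsSim f S T)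
    (hc : c = Prod.fst ∨ c = Prod.snd)
    (hS : IsInitial c S' S) (hT : IsInitial c T' T) (hcard : S'.card = T'.card) :
    IsSim f S' T' := by
  have hinj : Set.InjOn f S' := h.1.injOn.mono (by exact_mod_cast hS.1)
  have himg : S'.image f = T' := by
    refine IsInitial.eq_of_card (c := c) (S := T) ⟨?_, ?_⟩ hT ?_
    · intro q hq
      obtain ⟨p, hp, rfl⟩ := Finset.mem_image.1 hq
      exact h.mem (hS.1 hp)
    · intro q hq r hr hrq
      obtain ⟨p, hp, rfl⟩ := Finset.mem_image.1 hq
      obtain ⟨t, ht, rfl⟩ := h.exists_preimage hr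
      refine Finset.mem_image_of_mem f (hS.2 p hp t ht ?_)
      have := h.2 p (hS.1 hp) t ht
      rcases hc with rfl | rfl
      · exact not_lt.1 (mt this.1.1 (not_lt.2 hrq))
      · exact not_lt.1 (mt this.2.1 (not_lt.2 hrq))
    · rw [Finset.card_image_of_injOn hinj, hcard]
  refine ⟨?_, fun p hp q hq => h.2 p (hS.1 hp) q (hS.1 hq)⟩
  have := hinj.bijOn_image
  rwa [← Finset.coe_image, himg] at this

/-- The points of `G` with first coordinate less than `j`. -/
def lowFst (j : ℕ) (G : Finset (ℕ × ℕ)) : Finset (ℕ × ℕ) := G.filter fun p => p.1 < j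

/-- The points of `G` with second coordinate less than `j`. -/
def lowSnd (j : ℕ) (G : Finset (ℕ × ℕ)) : Finset (ℕ × ℕ) := G.filter fun p => p.2 < j

theorem mem_lowFst {j : ℕ} {G : Finset (ℕ × ℕ)} {p : ℕ × ℕ} :
    p ∈ lowFst j G ↔ p ∈ G ∧ p.1 < j := Finset.mem_filter

theorem mem_lowSnd {j : ℕ} {G : Finset (ℕ × ℕ)} {p : ℕ × ℕ} :
    p ∈ lowSnd j G ↔ p ∈ G ∧ p.2 < j := Finset.mem_filter

theorem isInitial_lowFst {i j : ℕ} (h : i ≤ j) (G : Finset (ℕ × ℕ)) :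
    IsInitial Prod.fst (lowFst i G) (lowFst j G) := by
  constructor
  · intro p hp
    rw [mem_lowFst] at *
    exact ⟨hp.1, hp.2.trans_le h⟩
  · intro p hp q hq hqp
    rw [mem_lowFst] at *
    exact ⟨hq.1, hqp.trans_lt hp.2⟩

theorem isInitial_lowSnd {i j : ℕ} (h : i ≤ j) (G : Finset (ℕ × ℕ)) :
    IsInitial Prod.snd (lowSnd i G) (lowSnd j G) := by
  constructor
  · intro p hp
    rw [mem_lowSnd] at *
    exact ⟨hp.1, hp.2.trans_le h⟩
  · intro p hp q hq hqp
    rw [mem_lowSnd] at *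
    exact ⟨hq.1, hqp.trans_lt hp.2⟩

/-- `G` is the graph of a permutation of `{0, ..., N - 1}`. -/
structure IsPermGraph (N : ℕ) (G : Finset (ℕ × ℕ)) : Prop where
  fst_lt : ∀ p ∈ G, p.1 < N
  snd_lt : ∀ p ∈ G, p.2 < N
  fst_inj : ∀ p ∈ G, ∀ q ∈ G, p.1 = q.1 → p = q
  snd_inj : ∀ p ∈ G, ∀ q ∈ G, p.2 = q.2 → p = q
  fst_surj : ∀ x < N, ∃ y, (x, y) ∈ G
  snd_surj : ∀ y < N, ∃ x, (x, y) ∈ G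

theorem IsPermGraph.card_lowFst {N j : ℕ} {G : Finset (ℕ × ℕ)} (hG : IsPermGraph N G)
    (hj : j ≤ N) : (lowFst j G).card = j := by
  have h : (lowFst j G).image Prod.fst = Finset.range j := by
    ext x
    simp only [Finset.mem_image, mem_lowFst, Finset.mem_range]
    constructor
    · rintro ⟨p, ⟨-, hp⟩, rfl⟩
      exact hp
    · intro hx
      obtain ⟨y, hy⟩ := hG.fst_surj x (by omega)
      exact ⟨(x, y), ⟨hy, hx⟩, rfl⟩
  have hinj : Set.InjOn Prod.fst (lowFst j G : Set (ℕ × ℕ)) := fun p hp q hq hpq =>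
    hG.fst_inj p (mem_lowFst.1 hp).1 q (mem_lowFst.1 hq).1 hpq
  rw [← Finset.card_image_of_injOn hinj, h, Finset.card_range]

theorem IsPermGraph.card_lowSnd {N j : ℕ} {G : Finset (ℕ × ℕ)} (hG : IsPermGraph N G)
    (hj : j ≤ N) : (lowSnd j G).card = j := by
  have h : (lowSnd j G).image Prod.snd = Finset.range j := by
    ext x
    simp only [Finset.mem_image, mem_lowSnd, Finset.mem_range]
    constructor
    · rintro ⟨p, ⟨-, hp⟩, rfl⟩
      exact hp
    · intro hx
      obtain ⟨y, hy⟩ := hG.snd_surj x (by omega)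
      exact ⟨(y, x), ⟨hy, hx⟩, rfl⟩
  have hinj : Set.InjOn Prod.snd (lowSnd j G : Set (ℕ × ℕ)) := fun p hp q hq hpq =>
    hG.snd_inj p (mem_lowSnd.1 hp).1 q (mem_lowSnd.1 hq).1 hpq
  rw [← Finset.card_image_of_injOn hinj, h, Finset.card_range]

theorem IsPermGraph.lowFst_self {N : ℕ} {G : Finset (ℕ × ℕ)} (hG : IsPermGraph N G) :
    lowFst N G = G := Finset.filter_true_of_mem hG.fst_lt

theorem IsPermGraph.lowSnd_self {N : ℕ} {G : Finset (ℕ × ℕ)} (hG : IsPermGraph N G) :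
    lowSnd N G = G := Finset.filter_true_of_mem hG.snd_lt

theorem IsPermGraph.sim_lowFst {n N M j : ℕ} {G H : Finset (ℕ × ℕ)} (hG : IsPermGraph N G)
    (hH : IsPermGraph M H) (hN : n ≤ N) (hM : n ≤ M) (hj : j ≤ n)
    (h : Sim (lowFst n G) (lowFst n H)) : Sim (lowFst j G) (lowFst j H) := by
  obtain ⟨f, hf⟩ := h
  refine ⟨f, hf.restrict (Or.inl rfl) (isInitial_lowFst hj G) (isInitial_lowFst hj H) ?_⟩
  rw [hG.card_lowFst (hj.trans hN), hH.card_lowFst (hj.trans hM)]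

theorem IsPermGraph.sim_lowSnd {n N M j : ℕ} {G H : Finset (ℕ × ℕ)} (hG : IsPermGraph N G)
    (hH : IsPermGraph M H) (hN : n ≤ N) (hM : n ≤ M) (hj : j ≤ n)
    (h : Sim (lowSnd n G) (lowSnd n H)) : Sim (lowSnd j G) (lowSnd j H) := by
  obtain ⟨f, hf⟩ := h
  refine ⟨f, hf.restrict (Or.inr rfl) (isInitial_lowSnd hj G) (isInitial_lowSnd hj H) ?_⟩
  rw [hG.card_lowSnd (hj.trans hN), hH.card_lowSnd (hj.trans hM)]

/-- The graph of a permutation of `Fin n`, as a set of points in `ℕ × ℕ`. -/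
def permGraph {n : ℕ} (π : Equiv.Perm (Fin n)) : Finset (ℕ × ℕ) :=
  Finset.univ.image fun i : Fin n => ((i : ℕ), (π i : ℕ))

theorem mem_permGraph {n : ℕ} {π : Equiv.Perm (Fin n)} {p : ℕ × ℕ} :
    p ∈ permGraph π ↔ ∃ i : Fin n, ((i : ℕ), (π i : ℕ)) = p := by
  simp [permGraph]

theorem isPermGraph_permGraph {n : ℕ} (π : Equiv.Perm (Fin n)) :
    IsPermGraph n (permGraph π) := by
  constructor
  · intro p hp
    obtain ⟨i, rfl⟩ := mem_permGraph.1 hp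
    exact i.2
  · intro p hp
    obtain ⟨i, rfl⟩ := mem_permGraph.1 hp
    exact (π i).2
  · intro p hp q hq h
    obtain ⟨i, rfl⟩ := mem_permGraph.1 hp
    obtain ⟨j, rfl⟩ := mem_permGraph.1 hq
    rw [Fin.ext h]
  · intro p hp q hq h
    obtain ⟨i, rfl⟩ := mem_permGraph.1 hp
    obtain ⟨j, rfl⟩ := mem_permGraph.1 hq
    rw [π.injective (Fin.ext h)]
  · intro x hx
    exact ⟨π ⟨x, hx⟩, mem_permGraph.2 ⟨⟨x, hx⟩, rfl⟩⟩
  · intro y hy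
    exact ⟨π⁻¹ ⟨y, hy⟩, mem_permGraph.2 ⟨π⁻¹ ⟨y, hy⟩, by simp⟩⟩

theorem IsPermGraph.exists_perm {N : ℕ} {G : Finset (ℕ × ℕ)} (hG : IsPermGraph N G) :
    ∃ π : Equiv.Perm (Fin N), permGraph π = G := by
  choose y hy using fun i : Fin N => hG.fst_surj i i.2
  have hinj : Function.Injective fun i : Fin N => (⟨y i, hG.snd_lt _ (hy i)⟩ : Fin N) := by
    intro i j hij
    have := hG.snd_inj _ (hy i) _ (hy j) (congrArg Fin.val hij)
    exact Fin.ext (congrArg Prod.fst this)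
  refine ⟨Equiv.ofBijective _ (Finite.injective_iff_bijective.1 hinj), ?_⟩
  ext p
  rw [mem_permGraph]
  constructor
  · rintro ⟨i, rfl⟩
    exact hy i
  · intro hp
    exact ⟨⟨p.1, hG.fst_lt p hp⟩, hG.fst_inj _ (hy _) _ hp rfl⟩

theorem eq_of_sim_permGraph {n : ℕ} {α β : Equiv.Perm (Fin n)}
    (h : Sim (permGraph α) (permGraph β)) : α = β := by
  obtain ⟨f, hf⟩ := h
  have key : ∀ p ∈ permGraph α, f p = p := by
    intro p hp
    have hα := isPermGraph_permGraph α
    have hβ := isPermGraph_permGraph β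
    have h1 : IsSim f (lowFst n (permGraph α)) (lowFst n (permGraph β)) := by
      rwa [hα.lowFst_self, hβ.lowFst_self]
    have h2 : IsSim f (lowSnd n (permGraph α)) (lowSnd n (permGraph β)) := by
      rwa [hα.lowSnd_self, hβ.lowSnd_self]
    have a1 : ∀ j ≤ n, IsSim f (lowFst j (permGraph α)) (lowFst j (permGraph β)) := fun j hj =>
      h1.restrict (Or.inl rfl) (isInitial_lowFst hj _) (isInitial_lowFst hj _)
        (by rw [hα.card_lowFst hj, hβ.card_lowFst hj])
    have a2 : ∀ j ≤ n, IsSim f (lowSnd j (permGraph α)) (lowSnd j (permGraph β)) := fun j hj =>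
      h2.restrict (Or.inr rfl) (isInitial_lowSnd hj _) (isInitial_lowSnd hj _)
        (by rw [hα.card_lowSnd hj, hβ.card_lowSnd hj])
    have b1 := hα.fst_lt p hp
    have b2 := hα.snd_lt p hp
    have u1 : (f p).1 < p.1 + 1 :=
      (mem_lowFst.1 ((a1 (p.1 + 1) b1).mem (mem_lowFst.2 ⟨hp, by omega⟩))).2
    have u2 : (f p).2 < p.2 + 1 :=
      (mem_lowSnd.1 ((a2 (p.2 + 1) b2).mem (mem_lowSnd.2 ⟨hp, by omega⟩))).2
    have l1 : ¬ (f p).1 < p.1 := by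
      intro hlt
      obtain ⟨q, hq, hqp⟩ := (a1 p.1 b1.le).exists_preimage (mem_lowFst.2 ⟨hf.mem hp, hlt⟩)
      have := hf.1.injOn (mem_lowFst.1 hq).1 hp hqp
      subst this
      exact lt_irrefl _ (mem_lowFst.1 hq).2
    have l2 : ¬ (f p).2 < p.2 := by
      intro hlt
      obtain ⟨q, hq, hqp⟩ := (a2 p.2 b2.le).exists_preimage (mem_lowSnd.2 ⟨hf.mem hp, hlt⟩)
      have := hf.1.injOn (mem_lowSnd.1 hq).1 hp hqp
      subst this
      exact lt_irrefl _ (mem_lowSnd.1 hq).2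
    exact Prod.ext (by omega) (by omega)
  ext i
  have hi : ((i : ℕ), (α i : ℕ)) ∈ permGraph α := mem_permGraph.2 ⟨i, rfl⟩
  have hi' := hf.mem hi
  rw [key _ hi] at hi'
  obtain ⟨j, hj⟩ := mem_permGraph.1 hi'
  obtain ⟨hj1, hj2⟩ := Prod.ext_iff.1 hj
  obtain rfl : j = i := Fin.ext hj1
  exact hj2.symm

theorem standardize_lt_iff {n k : ℕ} (v : Fin k → Fin n) (hv : Function.Injective v)
    (i j : Fin k) : standardize v hv i < standardize v hv j ↔ v i < v j := by
  simp [standardize]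

theorem sim_permGraph_pInit {n k : ℕ} (π : Equiv.Perm (Fin n)) (hk : k ≤ n) :
    Sim (permGraph (pInit π k hk)) (lowFst k (permGraph π)) := by
  refine ⟨fun p => if h : p.1 < n then (p.1, π ⟨p.1, h⟩) else p, ⟨?_, ?_, ?_⟩, ?_⟩
  · intro p hp
    obtain ⟨i, rfl⟩ := mem_permGraph.1 hp
    have : (i : ℕ) < n := i.2.trans_le hk
    simp only [this, dif_pos]
    exact mem_lowFst.2 ⟨mem_permGraph.2 ⟨⟨i, this⟩, rfl⟩, i.2⟩
  · intro p hp q hq hpq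
    obtain ⟨i, rfl⟩ := mem_permGraph.1 hp
    obtain ⟨j, rfl⟩ := mem_permGraph.1 hq
    have hi : (i : ℕ) < n := i.2.trans_le hk
    have hj : (j : ℕ) < n := j.2.trans_le hk
    simp only [hi, hj, dif_pos] at hpq
    rw [Fin.ext (Prod.ext_iff.1 hpq).1]
  · intro q hq
    obtain ⟨hq, hlt⟩ := mem_lowFst.1 hq
    obtain ⟨i, rfl⟩ := mem_permGraph.1 hq
    refine ⟨_, mem_permGraph.2 ⟨⟨i, hlt⟩, rfl⟩, ?_⟩
    simp
  · intro p hp q hq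
    obtain ⟨i, rfl⟩ := mem_permGraph.1 hp
    obtain ⟨j, rfl⟩ := mem_permGraph.1 hq
    have hi : (i : ℕ) < n := i.2.trans_le hk
    have hj : (j : ℕ) < n := j.2.trans_le hk
    simp only [hi, hj, dif_pos, true_and, Fin.val_fin_lt]
    exact standardize_lt_iff _ _ i j

theorem mem_permGraph_inv {n : ℕ} {π : Equiv.Perm (Fin n)} {p : ℕ × ℕ} :
    p ∈ permGraph π⁻¹ ↔ p.swap ∈ permGraph π := by
  rw [mem_permGraph, mem_permGraph]
  constructor
  · rintro ⟨i, rfl⟩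
    exact ⟨π⁻¹ i, by simp⟩
  · rintro ⟨i, hi⟩
    refine ⟨π i, ?_⟩
    rw [← Prod.swap_swap p, ← hi]
    simp

theorem Sim.swap {S T S' T' : Finset (ℕ × ℕ)} (h : Sim S T)
    (hS : ∀ p, p ∈ S' ↔ p.swap ∈ S) (hT : ∀ p, p ∈ T' ↔ p.swap ∈ T) : Sim S' T' := by
  obtain ⟨f, hf⟩ := h
  refine ⟨fun p => (f p.swap).swap, ⟨?_, ?_, ?_⟩, ?_⟩
  · intro p hp
    exact (hT _).2 (hf.mem ((hS p).1 hp))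
  · intro p hp q hq hpq
    exact Prod.swap_injective (hf.1.injOn ((hS p).1 hp) ((hS q).1 hq) (Prod.swap_injective hpq))
  · intro q hq
    obtain ⟨p, hp, hpq⟩ := hf.exists_preimage ((hT q).1 hq)
    exact ⟨p.swap, (hS _).2 hp, by simp [hpq]⟩
  · intro p hp q hq
    exact (hf.2 _ ((hS p).1 hp) _ ((hS q).1 hq)).symm

theorem sim_permGraph_vLow {n k : ℕ} (π : Equiv.Perm (Fin n)) (hk : k ≤ n) :
    Sim (permGraph (vLow π k hk)) (lowSnd k (permGraph π)) := by
  refine (sim_permGraph_pInit π⁻¹ hk).swap (fun p => mem_permGraph_inv) fun p => ?_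
  rw [mem_lowSnd, mem_lowFst, mem_permGraph_inv, Prod.swap_swap, Prod.fst_swap]

theorem mem_j2Set {a b : ℕ} {σ : Equiv.Perm (Fin a)} {τ : Equiv.Perm (Fin b)} {j : ℕ} :
    j ∈ j2Set σ τ ↔
      j ≤ a ∧ j ≤ b ∧ Sim (lowFst j (permGraph σ)) (lowSnd j (permGraph τ)) := by
  rw [j2Set, Finset.mem_filter]
  constructor
  · rintro ⟨-, ha, hb, h⟩
    refine ⟨ha, hb, (sim_permGraph_pInit σ ha).symm.trans ?_⟩
    rw [h]
    exact sim_permGraph_vLow τ hb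
  · rintro ⟨ha, hb, h⟩
    refine ⟨Finset.mem_range.2 (by omega), ha, hb, eq_of_sim_permGraph ?_⟩
    exact ((sim_permGraph_pInit σ ha).trans h).trans (sim_permGraph_vLow τ hb).symm

theorem isJ2Set_of_isPermGraph {N : ℕ} {G : Finset (ℕ × ℕ)} (hG : IsPermGraph N G)
    {S : Finset ℕ} (hS : ∀ j, j ∈ S ↔ j ≤ N ∧ Sim (lowFst j G) (lowSnd j G)) : IsJ2Set S := by
  obtain ⟨π, rfl⟩ := hG.exists_perm
  refine ⟨N, N, π, π, Finset.ext fun j => ?_⟩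
  rw [mem_j2Set, hS]
  tauto

theorem IsJ2Set.exists_isPermGraph {S : Finset ℕ} (hS : IsJ2Set S) {N : ℕ} (hN : N ∈ S)
    (hmax : ∀ x ∈ S, x ≤ N) :
    ∃ G, IsPermGraph N G ∧ ∀ j, j ∈ S ↔ j ≤ N ∧ Sim (lowFst j G) (lowSnd j G) := by
  obtain ⟨a, b, σ, τ, rfl⟩ := hS
  obtain ⟨ha, hb, hsim⟩ := mem_j2Set.1 hN
  have hG := isPermGraph_permGraph (pInit σ N ha)
  have hσ := isPermGraph_permGraph σ
  have hτ := isPermGraph_permGraph τ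
  have h1 := sim_permGraph_pInit σ ha
  have h2 := h1.trans hsim
  refine ⟨_, hG, fun j => ?_⟩
  have key : ∀ j ≤ N, Sim (lowFst j (permGraph (pInit σ N ha))) (lowFst j (permGraph σ)) ∧
      Sim (lowSnd j (permGraph (pInit σ N ha))) (lowSnd j (permGraph τ)) := fun j hj =>
    ⟨hG.sim_lowFst hσ le_rfl ha hj (by rwa [hG.lowFst_self]),
      hG.sim_lowSnd hτ le_rfl hb hj (by rwa [hG.lowSnd_self])⟩
  constructor
  · intro hj
    have hjN := hmax j hj
    obtain ⟨k1, k2⟩ := key j hjN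
    exact ⟨hjN, (k1.trans (mem_j2Set.1 hj).2.2).trans k2.symm⟩
  · rintro ⟨hjN, h⟩
    obtain ⟨k1, k2⟩ := key j hjN
    exact mem_j2Set.2 ⟨hjN.trans ha, hjN.trans hb, (k1.symm.trans h).trans k2⟩

theorem isSim_of_surjOn {f : ℕ × ℕ → ℕ × ℕ} {S T : Finset (ℕ × ℕ)} (hm : ∀ p ∈ S, f p ∈ T)
    (hs : ∀ q ∈ T, ∃ p ∈ S, f p = q)
    (ho : ∀ p ∈ S, ∀ q ∈ S,
      (p.1 < q.1 ↔ (f p).1 < (f q).1) ∧ (p.2 < q.2 ↔ (f p).2 < (f q).2)) : IsSim f S T := by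
  refine ⟨⟨hm, fun p hp q hq hpq => ?_, hs⟩, ho⟩
  have h1 := ho p hp q hq
  have h2 := ho q hq p hp
  rw [hpq] at h1 h2
  exact Prod.ext (by omega) (by omega)

theorem IsPermGraph.sim_of_isSim {N n j : ℕ} {G : Finset (ℕ × ℕ)} {f : ℕ × ℕ → ℕ × ℕ}
    (hG : IsPermGraph N G) (hnj : n ≤ j) (hj : j ≤ N) (hn : Sim (lowFst n G) (lowSnd n G))
    (hf : IsSim f (lowFst j G) (lowSnd j G)) {a : ℕ}
    (ha : ((lowFst n G).filter fun p => (f p).2 < n).card = a) :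
    Sim (lowFst a G) (lowSnd a G) := by
  set U := (lowFst n G).filter fun p => (f p).2 < n
  have hnN := hnj.trans hj
  have haN : a ≤ n := by
    rw [← ha, ← hG.card_lowFst hnN]
    exact Finset.card_filter_le _ _
  have hUn : U ⊆ lowFst n G := Finset.filter_subset _ _
  have hsub : lowFst n G ⊆ lowFst j G := (isInitial_lowFst hnj G).1
  have hinj : Set.InjOn f U := hf.1.injOn.mono (by exact_mod_cast hUn.trans hsub)
  have hUV : IsSim f U (U.image f) := by
    refine isSim_of_surjOn (fun p hp => Finset.mem_image_of_mem f hp)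
      (fun q hq => Finset.mem_image.1 hq) fun p hp q hq => ?_
    exact hf.2 p (hsub (hUn hp)) q (hsub (hUn hq))
  have hV : IsInitial Prod.fst (U.image f) (lowSnd n G) := by
    constructor
    · intro q hq
      obtain ⟨p, hp, rfl⟩ := Finset.mem_image.1 hq
      have hp' := Finset.mem_filter.1 hp
      exact mem_lowSnd.2 ⟨(mem_lowSnd.1 (hf.mem (hsub hp'.1))).1, hp'.2⟩
    · intro q hq r hr hrq
      obtain ⟨p, hp, rfl⟩ := Finset.mem_image.1 hq
      obtain ⟨t, ht, rfl⟩ := hf.exists_preimage ((isInitial_lowSnd hnj G).1 hr)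
      have h1 := (hf.2 p (hsub (hUn hp)) t ht).1
      have h2 := (mem_lowFst.1 (hUn hp)).2
      refine Finset.mem_image_of_mem f (Finset.mem_filter.2
        ⟨mem_lowFst.2 ⟨(mem_lowFst.1 ht).1, by omega⟩, (mem_lowSnd.1 hr).2⟩)
  have hU' : IsInitial Prod.snd U (lowFst n G) := by
    refine ⟨hUn, fun p hp q hq hqp => Finset.mem_filter.2 ⟨hq, ?_⟩⟩
    have h1 := (hf.2 p (hsub (hUn hp)) q (hsub hq)).2
    have h2 := (Finset.mem_filter.1 hp).2
    omega
  obtain ⟨g, hg⟩ := hn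
  have s1 : Sim (lowFst a G) (U.image f) :=
    ⟨g, hg.restrict (Or.inl rfl) (isInitial_lowFst haN G) hV
      (by rw [hG.card_lowFst (haN.trans hnN), Finset.card_image_of_injOn hinj, ha])⟩
  have s2 : Sim U (lowSnd a G) :=
    ⟨g, hg.restrict (Or.inr rfl) hU' (isInitial_lowSnd haN G)
      (by rw [hG.card_lowSnd (haN.trans hnN), ha])⟩
  exact (s1.trans (Sim.symm ⟨f, hUV⟩)).trans s2

theorem isPermGraph_image {N : ℕ} {w : ℕ → ℕ} (hw : ∀ x < N, w x < N)
    (hs : ∀ y < N, ∃ x < N, w x = y) :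
    IsPermGraph N ((Finset.range N).image fun x => (x, w x)) := by
  have hinj : Set.InjOn w (Finset.range N) :=
    Finset.injOn_of_surjOn_of_card_le (t := Finset.range N) w
      (fun x hx => by simpa using hw x (by simpa using hx))
      (fun y hy => by simpa using hs y (by simpa using hy)) le_rfl
  constructor
  · intro p hp
    obtain ⟨x, hx, rfl⟩ := Finset.mem_image.1 hp
    exact Finset.mem_range.1 hx
  · intro p hp
    obtain ⟨x, hx, rfl⟩ := Finset.mem_image.1 hp
    exact hw x (Finset.mem_range.1 hx)
  · intro p hp q hq h
    obtain ⟨x, hx, rfl⟩ := Finset.mem_image.1 hp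
    obtain ⟨y, hy, rfl⟩ := Finset.mem_image.1 hq
    obtain rfl : x = y := h
    rfl
  · intro p hp q hq h
    obtain ⟨x, hx, rfl⟩ := Finset.mem_image.1 hp
    obtain ⟨y, hy, rfl⟩ := Finset.mem_image.1 hq
    rw [hinj hx hy h]
  · intro x hx
    exact ⟨w x, Finset.mem_image.2 ⟨x, Finset.mem_range.2 hx, rfl⟩⟩
  · intro y hy
    obtain ⟨x, hx, rfl⟩ := hs y hy
    exact ⟨x, Finset.mem_image.2 ⟨x, Finset.mem_range.2 hx, rfl⟩⟩

/-- A permutation of size `n` whose patterns on the first `n - k` positions and on the lowest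
`n - k` values agree is both the pattern on the first `n` positions and the pattern on the
lowest `n` values of a permutation of size `n + m` having `k` values `≥ n` in its first `n`
positions, these being its largest `k` values. -/
theorem IsPermGraph.exists_extension {n k m : ℕ} {H : Finset (ℕ × ℕ)} (hH : IsPermGraph n H)
    (hk1 : 1 ≤ k) (hkn : k ≤ n) (hkm : k ≤ m)
    (h : Sim (lowFst (n - k) H) (lowSnd (n - k) H)) :
    ∃ G, IsPermGraph (n + m) G ∧ Sim (lowFst n G) H ∧ Sim (lowSnd n G) H ∧
      (∃ x < n, (x, n + m - 1) ∈ G) ∧ (∀ p ∈ G, p.2 < n → p.1 < n + k) ∧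
      ∀ p ∈ G, p.1 < n + k → n ≤ p.2 → n + m - k ≤ p.2 := by
  obtain ⟨ψ, hψ⟩ := h.symm
  have hex : ∀ x, ∃ y, x < n → (x, y) ∈ H := fun x => by
    by_cases hx : x < n
    · obtain ⟨y, hy⟩ := hH.fst_surj x hx
      exact ⟨y, fun _ => hy⟩
    · exact ⟨0, fun h => absurd h hx⟩
  choose a ha using hex
  have han : ∀ x < n, a x < n := fun x hx => hH.snd_lt _ (ha x hx)
  have ha_eq : ∀ p ∈ H, p.2 = a p.1 := fun p hp =>
    congrArg Prod.snd (hH.fst_inj p hp _ (ha p.1 (hH.fst_lt p hp)) rfl)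
  have ha_surj : ∀ y < n, ∃ x < n, a x = y := fun y hy => by
    obtain ⟨x, hx⟩ := hH.snd_surj y hy
    exact ⟨x, hH.fst_lt _ hx, (ha_eq _ hx).symm⟩
  have hlow : ∀ x < n, a x < n - k → (x, a x) ∈ lowSnd (n - k) H := fun x hx hax =>
    mem_lowSnd.2 ⟨ha x hx, hax⟩
  have hψm : ∀ x < n, a x < n - k → ψ (x, a x) ∈ H ∧ (ψ (x, a x)).1 < n - k :=
    fun x hx hax => mem_lowFst.1 (hψ.mem (hlow x hx hax))
  have hψn : ∀ x < n, a x < n - k → (ψ (x, a x)).2 < n := fun x hx hax =>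
    hH.snd_lt _ (hψm x hx hax).1
  have hψs : ∀ z < n - k, ∃ x < n, a x < n - k ∧ ψ (x, a x) = (z, a z) := fun z hz => by
    obtain ⟨p, hp, hpz⟩ := hψ.exists_preimage (q := (z, a z))
      (mem_lowFst.2 ⟨ha z (by omega), hz⟩)
    obtain ⟨hp, hp2⟩ := mem_lowSnd.1 hp
    have hpa := ha_eq p hp
    refine ⟨p.1, hH.fst_lt p hp, by omega, ?_⟩
    rw [← hpa]
    exact hpz
  have hψo : ∀ x < n, a x < n - k → ∀ y < n, a y < n - k →
      (x < y ↔ (ψ (x, a x)).1 < (ψ (y, a y)).1) ∧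
      (a x < a y ↔ (ψ (x, a x)).2 < (ψ (y, a y)).2) := fun x hx hax y hy hay =>
    hψ.2 _ (hlow x hx hax) _ (hlow y hy hay)
  obtain ⟨w, hwA, hwB, hwC, hwD⟩ : ∃ w : ℕ → ℕ,
      (∀ x < n, a x < n - k → w x = (ψ (x, a x)).2) ∧
      (∀ x < n, n - k ≤ a x → w x = a x + m) ∧
      (∀ x, n ≤ x → x < n + k → w x = a (x - k)) ∧
      (∀ x, n + k ≤ x → w x = x - k) := by
    refine ⟨fun x => if x < n then (if a x < n - k then (ψ (x, a x)).2 else a x + m) else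
      if x < n + k then a (x - k) else x - k, ?_, ?_, ?_, ?_⟩
    · intro x hx hax
      simp [hx, hax]
    · intro x hx hax
      simp [hx, not_lt.2 hax]
    · intro x hx hxk
      simp [not_lt.2 hx, hxk]
    · intro x hx
      have : n ≤ x := by omega
      simp [not_lt.2 hx, not_lt.2 this]
  have hcases : ∀ x, (x < n ∧ a x < n - k ∧ w x = (ψ (x, a x)).2 ∧ w x < n) ∨
      (x < n ∧ n - k ≤ a x ∧ a x < n ∧ w x = a x + m) ∨
      (n ≤ x ∧ x < n + k ∧ w x = a (x - k) ∧ w x < n) ∨ (n + k ≤ x ∧ w x = x - k) := by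
    intro x
    by_cases hx : x < n
    · by_cases hax : a x < n - k
      · exact Or.inl ⟨hx, hax, hwA x hx hax, by rw [hwA x hx hax]; exact hψn x hx hax⟩
      · exact Or.inr (Or.inl ⟨hx, by omega, han x hx, hwB x hx (by omega)⟩)
    · by_cases hxk : x < n + k
      · refine Or.inr (Or.inr (Or.inl ⟨by omega, hxk, hwC x (by omega) hxk, ?_⟩))
        rw [hwC x (by omega) hxk]
        exact han _ (by omega)
      · exact Or.inr (Or.inr (Or.inr ⟨by omega, hwD x (by omega)⟩))
  have hG : IsPermGraph (n + m) ((Finset.range (n + m)).image fun x => (x, w x)) := by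
    refine isPermGraph_image (fun x hx => ?_) fun y hy => ?_
    · rcases hcases x with h | h | h | h <;> omega
    · by_cases h1 : y < n
      · obtain ⟨z, hz, rfl⟩ := ha_surj y h1
        by_cases h2 : z < n - k
        · obtain ⟨x, hx, hax, hxz⟩ := hψs z h2
          exact ⟨x, by omega, by rw [hwA x hx hax, hxz]⟩
        · exact ⟨z + k, by omega, by rw [hwC _ (by omega) (by omega), Nat.add_sub_cancel]⟩
      · by_cases h2 : y < n + m - k
        · exact ⟨y + k, by omega, by rw [hwD _ (by omega), Nat.add_sub_cancel]⟩
        · obtain ⟨x, hx, hax⟩ := ha_surj (y - m) (by omega)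
          exact ⟨x, by omega, by rw [hwB x hx (by omega)]; omega⟩
  set G := (Finset.range (n + m)).image fun x => (x, w x) with hGdef
  have hmem : ∀ p, p ∈ G ↔ p.1 < n + m ∧ p.2 = w p.1 := fun p => by
    rw [hGdef, Finset.mem_image]
    constructor
    · rintro ⟨x, hx, rfl⟩
      exact ⟨Finset.mem_range.1 hx, rfl⟩
    · rintro ⟨h1, h2⟩
      exact ⟨p.1, Finset.mem_range.2 h1, by rw [← h2]⟩
  refine ⟨G, hG, ⟨fun p => (p.1, a p.1), isSim_of_surjOn ?_ ?_ ?_⟩,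
    ⟨fun p => if p.1 < n then ψ (p.1, a p.1) else (p.1 - k, p.2), isSim_of_surjOn ?_ ?_ ?_⟩,
    ?_, ?_, ?_⟩
  · intro p hp
    exact ha _ (mem_lowFst.1 hp).2
  · intro q hq
    have hq1 := hH.fst_lt q hq
    refine ⟨(q.1, w q.1), mem_lowFst.2 ⟨(hmem _).2 ⟨by simp only; omega, rfl⟩, hq1⟩, ?_⟩
    exact Prod.ext rfl (ha_eq q hq).symm
  · intro p hp q hq
    obtain ⟨hp, hpn⟩ := mem_lowFst.1 hp
    obtain ⟨hq, hqn⟩ := mem_lowFst.1 hq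
    refine ⟨Iff.rfl, ?_⟩
    rw [((hmem p).1 hp).2, ((hmem q).1 hq).2]
    simp only
    rcases hcases p.1 with h | h | h | h <;> rcases hcases q.1 with h' | h' | h' | h' <;>
      try omega
    rw [(hψo p.1 hpn h.2.1 q.1 hqn h'.2.1).2, h.2.2.1, h'.2.2.1]
  · intro p hp
    obtain ⟨hp, hpn⟩ := mem_lowSnd.1 hp
    have hpw := ((hmem p).1 hp).2
    rcases hcases p.1 with h | h | h | h
    · simp only [h.1, if_true]
      exact (hψm _ h.1 h.2.1).1
    · omega
    · simp only [not_lt.2 h.1, if_false]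
      rw [hpw, h.2.2.1]
      exact ha _ (by omega)
    · omega
  · intro q hq
    have hq1 := hH.fst_lt q hq
    have hqa := ha_eq q hq
    by_cases hz : q.1 < n - k
    · obtain ⟨x, hx, hax, hxz⟩ := hψs q.1 hz
      refine ⟨(x, w x), mem_lowSnd.2 ⟨(hmem _).2 ⟨by simp only; omega, rfl⟩, ?_⟩, ?_⟩
      · rw [hwA x hx hax]
        exact hψn x hx hax
      · simp only [hx, if_true]
        rw [hxz, ← hqa]
    · have hw := hwC (q.1 + k) (by omega) (by omega)
      rw [Nat.add_sub_cancel, ← hqa] at hw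
      refine ⟨(q.1 + k, q.2), mem_lowSnd.2 ⟨(hmem _).2 ⟨by simp only; omega, hw.symm⟩,
        hH.snd_lt q hq⟩, ?_⟩
      simp only [show ¬ q.1 + k < n by omega, if_false, Nat.add_sub_cancel]
  · intro p hp q hq
    obtain ⟨hp, hpn⟩ := mem_lowSnd.1 hp
    obtain ⟨hq, hqn⟩ := mem_lowSnd.1 hq
    have hpw := ((hmem p).1 hp).2
    have hqw := ((hmem q).1 hq).2
    rcases hcases p.1 with h | h | h | h <;> rcases hcases q.1 with h' | h' | h' | h' <;>
      try omega
    · simp only [h.1, h'.1, if_true]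
      refine ⟨(hψo p.1 h.1 h.2.1 q.1 h'.1 h'.2.1).1, ?_⟩
      rw [hpw, hqw, h.2.2.1, h'.2.2.1]
    · have := (hψm p.1 h.1 h.2.1).2
      simp only [h.1, not_lt.2 h'.1, if_true, if_false]
      rw [hpw, h.2.2.1]
      exact ⟨by omega, Iff.rfl⟩
    · have := (hψm q.1 h'.1 h'.2.1).2
      simp only [h'.1, not_lt.2 h.1, if_true, if_false]
      rw [hqw, h'.2.2.1]
      exact ⟨by omega, Iff.rfl⟩
    · simp only [not_lt.2 h.1, not_lt.2 h'.1, if_false, and_true]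
      omega
  · obtain ⟨x, hx, hax⟩ := ha_surj (n - 1) (by omega)
    exact ⟨x, hx, (hmem _).2 ⟨by simp only; omega, by
      simp only
      rw [hwB x hx (by omega)]
      omega⟩⟩
  · intro p hp hpn
    have hpw := ((hmem p).1 hp).2
    have := ((hmem p).1 hp).1
    rcases hcases p.1 with h | h | h | h <;> omega
  · intro p hp hpk hpn
    have hpw := ((hmem p).1 hp).2
    rcases hcases p.1 with h | h | h | h <;> omega

theorem IsPermGraph.not_sim_of_extension {n k m j : ℕ} {G : Finset (ℕ × ℕ)}
    (hG : IsPermGraph (n + m) G) (hk1 : 1 ≤ k) (hkn : k ≤ n) (hkm : k ≤ m) (hnj : n < j)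
    (hjm : j < n + m) (hn : Sim (lowFst n G) (lowSnd n G))
    (hgap : ∀ i, n - k < i → i < n → ¬ Sim (lowFst i G) (lowSnd i G))
    (htop : ∃ x < n, (x, n + m - 1) ∈ G) (hlow : ∀ p ∈ G, p.2 < n → p.1 < n + k)
    (hhigh : ∀ p ∈ G, p.1 < n + k → n ≤ p.2 → n + m - k ≤ p.2) :
    ¬ Sim (lowFst j G) (lowSnd j G) := by
  rintro ⟨f, hf⟩
  obtain ⟨x, hxn, hx⟩ := htop
  have hsub : lowFst n G ⊆ lowFst j G := (isInitial_lowFst hnj.le G).1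
  have hsub' : lowSnd n G ⊆ lowSnd j G := (isInitial_lowSnd hnj.le G).1
  have hcard := hG.card_lowFst (j := n) (by omega)
  have hsplit := Finset.card_filter_add_card_filter_not (s := lowFst n G) fun p => (f p).2 < n
  set U := (lowFst n G).filter fun p => (f p).2 < n
  set V := (lowFst n G).filter fun p => ¬ (f p).2 < n
  have hxl : (x, n + m - 1) ∈ lowFst n G := mem_lowFst.2 ⟨hx, hxn⟩
  have hxV : (x, n + m - 1) ∈ V := by
    refine Finset.mem_filter.2 ⟨hxl, fun hlt => ?_⟩
    obtain ⟨z, hz⟩ := hG.snd_surj (j - 1) (by omega)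
    obtain ⟨t, ht, htz⟩ := hf.exists_preimage (q := (z, j - 1))
      (mem_lowSnd.2 ⟨hz, by simp only; omega⟩)
    have h1 := (hf.2 _ (hsub hxl) t ht).2
    have h2 := hG.snd_lt t (mem_lowFst.1 ht).1
    rw [htz] at h1
    simp only at h1
    omega
  have hVpos : 0 < V.card := Finset.card_pos.2 ⟨_, hxV⟩
  have hUk : U.card ≤ n - k := by
    by_contra hlt
    exact hgap U.card (by omega) (by omega) (hG.sim_of_isSim hnj.le hjm.le hn hf rfl)
  have hVle : V.card ≤ (Finset.Ico (n + m - k) (n + m - 1)).card := by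
    refine Finset.card_le_card_of_injOn (fun p => (f p).2) (fun p hp => ?_) ?_
    · obtain ⟨hpn, hfp⟩ := Finset.mem_filter.1 hp
      have hfm := mem_lowSnd.1 (hf.mem (hsub hpn))
      have hfk : (f p).1 < n + k := by
        by_contra hge
        have hle : (lowSnd n G).card ≤ (lowFst p.1 G).card := by
          obtain ⟨g, hg, -, hfg⟩ := hf.exists_inverse
          refine Finset.card_le_card_of_injOn g (fun q hq => ?_)
            (hg.1.injOn.mono (by exact_mod_cast hsub'))
          have hgq := hg.mem (hsub' hq)
          have hqk := hlow q (mem_lowSnd.1 hq).1 (mem_lowSnd.1 hq).2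
          have h1 := (hf.2 _ hgq p (hsub hpn)).1
          rw [hfg q (hsub' hq)] at h1
          exact mem_lowFst.2 ⟨(mem_lowFst.1 hgq).1, h1.2 (by omega)⟩
        have hpn' := (mem_lowFst.1 hpn).2
        rw [hG.card_lowSnd (by omega), hG.card_lowFst (by omega)] at hle
        omega
      have := hhigh _ hfm.1 hfk (by omega)
      simp only [Finset.coe_Ico, Set.mem_Ico]
      omega
    · intro p hp q hq hpq
      have hp' := hsub (Finset.mem_filter.1 hp).1
      have hq' := hsub (Finset.mem_filter.1 hq).1
      exact hf.1.injOn hp' hq' (hG.snd_inj _ (mem_lowSnd.1 (hf.mem hp')).1 _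
        (mem_lowSnd.1 (hf.mem hq')).1 hpq)
  rw [Nat.card_Ico] at hVle
  omega

theorem IsPermGraph.insert_corner {n : ℕ} {H : Finset (ℕ × ℕ)} (hH : IsPermGraph n H) :
    IsPermGraph (n + 1) (insert (n, n) H) := by
  constructor
  · intro p hp
    rcases Finset.mem_insert.1 hp with rfl | hp
    · exact Nat.lt_succ_self n
    · exact (hH.fst_lt p hp).trans (Nat.lt_succ_self n)
  · intro p hp
    rcases Finset.mem_insert.1 hp with rfl | hp
    · exact Nat.lt_succ_self n
    · exact (hH.snd_lt p hp).trans (Nat.lt_succ_self n)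
  · intro p hp q hq h
    rcases Finset.mem_insert.1 hp with rfl | hp <;> rcases Finset.mem_insert.1 hq with rfl | hq
    · rfl
    · exact absurd h (hH.fst_lt q hq).ne'
    · exact absurd h (hH.fst_lt p hp).ne
    · exact hH.fst_inj p hp q hq h
  · intro p hp q hq h
    rcases Finset.mem_insert.1 hp with rfl | hp <;> rcases Finset.mem_insert.1 hq with rfl | hq
    · rfl
    · exact absurd h (hH.snd_lt q hq).ne'
    · exact absurd h (hH.snd_lt p hp).ne
    · exact hH.snd_inj p hp q hq h
  · intro x hx
    rcases Nat.lt_succ_iff_lt_or_eq.1 hx with h | rfl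
    · obtain ⟨y, hy⟩ := hH.fst_surj x h
      exact ⟨y, Finset.mem_insert_of_mem hy⟩
    · exact ⟨x, Finset.mem_insert_self _ _⟩
  · intro x hx
    rcases Nat.lt_succ_iff_lt_or_eq.1 hx with h | rfl
    · obtain ⟨y, hy⟩ := hH.snd_surj x h
      exact ⟨y, Finset.mem_insert_of_mem hy⟩
    · exact ⟨x, Finset.mem_insert_self _ _⟩

/-- If the first `n` positions carry the values `< n`, then adjoining the next position or the
next value yields the same pattern. -/
theorem IsPermGraph.sim_succ {n N : ℕ} {G : Finset (ℕ × ℕ)} (hG : IsPermGraph N G)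
    (hnN : n < N) (h : lowFst n G = lowSnd n G) :
    Sim (lowFst (n + 1) G) (lowSnd (n + 1) G) := by
  have hiff : ∀ p ∈ G, (p.1 < n ↔ p.2 < n) := fun p hp => by
    have := Finset.ext_iff.1 h p
    rw [mem_lowFst, mem_lowSnd] at this
    tauto
  obtain ⟨x, hx⟩ := hG.snd_surj n hnN
  have hxn := hiff _ hx
  simp only at hxn
  refine ⟨fun p => if p.1 < n then p else (x, n), isSim_of_surjOn ?_ ?_ ?_⟩
  · intro p hp
    have hp' := mem_lowFst.1 hp
    by_cases hpn : p.1 < n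
    · simp only [hpn, if_true]
      have := (hiff p hp'.1).1 hpn
      exact mem_lowSnd.2 ⟨hp'.1, by omega⟩
    · simp only [hpn, if_false]
      exact mem_lowSnd.2 ⟨hx, Nat.lt_succ_self n⟩
  · intro q hq
    obtain ⟨hq, hqn⟩ := mem_lowSnd.1 hq
    by_cases hq1 : q.1 < n
    · exact ⟨q, mem_lowFst.2 ⟨hq, by omega⟩, by simp [hq1]⟩
    · obtain ⟨y, hy⟩ := hG.fst_surj n hnN
      have hq2 : q.2 = n := by
        have := hiff q hq
        omega
      refine ⟨(n, y), mem_lowFst.2 ⟨hy, Nat.lt_succ_self n⟩, ?_⟩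
      simp only [lt_irrefl, if_false]
      exact hG.snd_inj _ hx _ hq hq2.symm
  · intro p hp q hq
    obtain ⟨hp, hpn⟩ := mem_lowFst.1 hp
    obtain ⟨hq, hqn⟩ := mem_lowFst.1 hq
    have h1 := hiff p hp
    have h2 := hiff q hq
    by_cases hp1 : p.1 < n <;> by_cases hq1 : q.1 < n
    · simp only [hp1, hq1, if_true, and_self]
    · simp only [hp1, hq1, if_true, if_false]
      omega
    · simp only [hp1, hq1, if_true, if_false]
      omega
    · have hpq := hG.fst_inj p hp q hq (by omega)
      subst hpq
      simp

/-- Let `J` be a j₂-set whose two largest elements are `n - k` and `n`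
(`k ≥ 1`), and let `m ≥ 1`.  Then `J ∪ {n+m}` is a j₂-set iff `m = 1` or `m ≥ k`. -/
theorem stmt16 (J : Finset ℕ) (n k m : ℕ) (hJ : IsJ2Set J)
    (hk1 : 1 ≤ k) (hkn : k ≤ n) (hm : 1 ≤ m)
    (hn : n ∈ J) (hnk : n - k ∈ J)
    (hmax : ∀ x ∈ J, x ≤ n) (hmax2 : ∀ x ∈ J, x ≠ n → x ≤ n - k) :
    IsJ2Set (J ∪ {n + m}) ↔ m = 1 ∨ k ≤ m := by
  have hext : ∀ G, IsPermGraph (n + m) G →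
      (∀ j ≤ n, j ∈ J ↔ Sim (lowFst j G) (lowSnd j G)) →
      (∀ j, n < j → j < n + m → ¬ Sim (lowFst j G) (lowSnd j G)) → IsJ2Set (J ∪ {n + m}) := by
    intro G hG hle hgt
    refine isJ2Set_of_isPermGraph hG fun j => ?_
    rw [Finset.mem_union, Finset.mem_singleton]
    rcases le_or_gt j n with hj | hj
    · rw [hle j hj]
      exact ⟨fun h => ⟨by omega, h.resolve_right (by omega)⟩, fun h => Or.inl h.2⟩
    · have hjJ : j ∉ J := fun h => absurd (hmax j h) (by omega)
      rcases lt_trichotomy j (n + m) with h | rfl | h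
      · have := hgt j hj h
        have := h.ne
        tauto
      · rw [hG.lowFst_self, hG.lowSnd_self]
        exact ⟨fun _ => ⟨le_rfl, Sim.refl G⟩, fun _ => Or.inr rfl⟩
      · constructor
        · rintro (h' | h')
          · exact absurd h' hjJ
          · omega
        · rintro ⟨h', -⟩
          omega
  obtain ⟨H, hH, hHJ⟩ := hJ.exists_isPermGraph hn hmax
  constructor
  · intro h
    obtain ⟨G, hG, hGJ⟩ := h.exists_isPermGraph (N := n + m) (by simp) (fun x hx => by
      rcases Finset.mem_union.1 hx with hx | hx
      · exact (hmax x hx).trans (Nat.le_add_right n m)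
      · exact (Finset.mem_singleton.1 hx).le)
    by_contra! hcon
    have hsim := ((hGJ n).1 (Finset.mem_union_left _ hn)).2
    have hself : IsSim id (lowFst (n + m) G) (lowSnd (n + m) G) := by
      rw [hG.lowFst_self, hG.lowSnd_self]
      exact ⟨Set.bijOn_id _, fun _ _ _ _ => ⟨Iff.rfl, Iff.rfl⟩⟩
    have hcard := hG.card_lowFst (j := n) (by omega)
    have hcard' := hG.card_lowSnd (j := n) (by omega)
    have hsplit := Finset.card_filter_add_card_filter_not (s := lowFst n G) fun p => (id p).2 < n
    have hU := hG.sim_of_isSim (by omega) le_rfl hsim hself rfl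
    set U := (lowFst n G).filter fun p => (id p).2 < n
    set V := (lowFst n G).filter fun p => ¬ (id p).2 < n
    have hVm : V.card ≤ (Finset.Ico n (n + m)).card := by
      refine Finset.card_le_card_of_injOn Prod.snd (fun p hp => ?_) fun p hp q hq hpq => ?_
      · obtain ⟨hp1, hp2⟩ := Finset.mem_filter.1 hp
        have := hG.snd_lt p (mem_lowFst.1 hp1).1
        simp only [Finset.coe_Ico, Set.mem_Ico]
        exact ⟨not_lt.1 hp2, this⟩
      · exact hG.snd_inj p (mem_lowFst.1 (Finset.mem_filter.1 hp).1).1 q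
          (mem_lowFst.1 (Finset.mem_filter.1 hq).1).1 hpq
    rw [Nat.card_Ico] at hVm
    have hUJ : U.card ∈ J := by
      have := (hGJ U.card).2 ⟨by omega, hU⟩
      rw [Finset.mem_union, Finset.mem_singleton] at this
      exact this.resolve_right (by omega)
    have hUn : U.card = n := by
      by_contra hne
      have := hmax2 _ hUJ hne
      omega
    have hlow : lowFst n G = lowSnd n G := by
      refine Finset.eq_of_subset_of_card_le (fun p hp => ?_) (by omega)
      have hUsub : U ⊆ lowFst n G := Finset.filter_subset _ _
      have hpU : p ∈ U := by
        rwa [Finset.eq_of_subset_of_card_le hUsub (by omega)]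
      exact mem_lowSnd.2 ⟨(mem_lowFst.1 hp).1, (Finset.mem_filter.1 hpU).2⟩
    have hsucc := (hGJ (n + 1)).2 ⟨by omega, hG.sim_succ (by omega) hlow⟩
    rcases Finset.mem_union.1 hsucc with h1 | h1
    · have := hmax _ h1
      omega
    · have := Finset.mem_singleton.1 h1
      omega
  · rintro (rfl | hkm)
    · refine hext _ hH.insert_corner (fun j hj => ?_) fun j h1 h2 => absurd h1 (by omega)
      have h1 : lowFst j (insert (n, n) H) = lowFst j H := by
        rw [lowFst, Finset.filter_insert, if_neg (not_lt.2 hj), lowFst]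
      have h2 : lowSnd j (insert (n, n) H) = lowSnd j H := by
        rw [lowSnd, Finset.filter_insert, if_neg (not_lt.2 hj), lowSnd]
      rw [hHJ, h1, h2]
      exact and_iff_right hj
    · obtain ⟨G, hG, h1, h2, htop, hlow, hhigh⟩ :=
        hH.exists_extension hk1 hkn hkm ((hHJ _).1 hnk).2
      have hle : ∀ j ≤ n, j ∈ J ↔ Sim (lowFst j G) (lowSnd j G) := fun j hj => by
        have s1 := hG.sim_lowFst hH (by omega) le_rfl hj (by rwa [hH.lowFst_self])
        have s2 := hG.sim_lowSnd hH (by omega) le_rfl hj (by rwa [hH.lowSnd_self])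
        rw [hHJ]
        exact ⟨fun h => (s1.trans h.2).trans s2.symm, fun h => ⟨hj, (s1.symm.trans h).trans s2⟩⟩
      refine hext G hG hle fun j hj hjm => ?_
      refine hG.not_sim_of_extension hk1 hkn hkm hj hjm ((hle n le_rfl).1 hn) (fun i hi hin hs => ?_)
        htop hlow hhigh
      have := hmax2 i ((hle i hin.le).2 hs) hin.ne
      omega

end QT
end

section
/- For every real number q with 0 < q < 1, log ∏_{i ≥ 1} (1 - q^i)^{-i} < (1 + q/(1-q)^2) · (1 + log(1/(1-q))); in particular the infinite product ∏_{i ≥ 1} (1 - q^i)^{-i} converges. -/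
namespace QT


/-- Convexity of `-log (1 - x)` along the segment from `0` to `q`. -/
theorem neg_log_one_sub_mul_le {q t : ℝ} (hq : q < 1) (ht0 : 0 ≤ t) (ht1 : t ≤ 1) :
    -Real.log (1 - t * q) ≤ t * -Real.log (1 - q) := by
  have h := rpow_one_add_le_one_add_mul_self (s := -q) (by linarith) ht0 ht1
  have hlog := Real.log_le_log (Real.rpow_pos_of_pos (by linarith) t) h
  rw [Real.log_rpow (by linarith)] at hlog
  simp only [mul_neg, ← sub_eq_add_neg] at hlog ⊢
  linarith

/-- The weighted geometric series `∑ (i + 1) q ^ i`. -/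
theorem hasSum_succ_mul_pow {q : ℝ} (h0 : 0 ≤ q) (h1 : q < 1) :
    HasSum (fun i : ℕ => ((i : ℝ) + 1) * q ^ i) (1 / (1 - q) ^ 2) := by
  simpa using hasSum_choose_mul_geometric_of_norm_lt_one 1
    (show ‖q‖ < 1 by rwa [Real.norm_of_nonneg h0])

/-- For `0 < q < 1`, the infinite product `∏_{i ≥ 1} (1 - q^i)^{-i}`
converges and
`log ∏_{i ≥ 1} (1 - q^i)^{-i} < (1 + q/(1-q)²)(1 + log(1/(1-q)))`. -/
theorem stmt18 (q : ℝ) (h0 : 0 < q) (h1 : q < 1) :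
    Multipliable (fun i : ℕ => ((1 - q ^ (i + 1)) ^ (i + 1))⁻¹) ∧
    Real.log (∏' i : ℕ, ((1 - q ^ (i + 1)) ^ (i + 1))⁻¹) <
      (1 + q / (1 - q) ^ 2) * (1 + Real.log (1 / (1 - q))) := by
  have hpow (i : ℕ) : q ^ (i + 1) < 1 := pow_lt_one₀ h0.le h1 i.succ_ne_zero
  set L := -Real.log (1 - q) with hL
  have hlog (i : ℕ) : Real.log ((1 - q ^ (i + 1)) ^ (i + 1))⁻¹ =
      ((i : ℝ) + 1) * -Real.log (1 - q ^ (i + 1)) := by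
    rw [Real.log_inv, Real.log_pow]
    push_cast
    ring
  have hpos (i : ℕ) : 0 < ((1 - q ^ (i + 1)) ^ (i + 1))⁻¹ :=
    inv_pos.2 (pow_pos (sub_pos.2 (hpow i)) _)
  have hnonneg (i : ℕ) : 0 ≤ Real.log ((1 - q ^ (i + 1)) ^ (i + 1))⁻¹ := by
    rw [hlog]
    have := Real.log_nonpos (sub_nonneg.2 (hpow i).le) (by linarith [pow_pos h0 (i + 1)])
    exact mul_nonneg (by positivity) (neg_nonneg.2 this)
  have hle (i : ℕ) : Real.log ((1 - q ^ (i + 1)) ^ (i + 1))⁻¹ ≤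
      ((i : ℝ) + 1) * q ^ i * L := by
    rw [hlog, mul_assoc, pow_succ]
    gcongr
    exact neg_log_one_sub_mul_le h1 (by positivity) (pow_le_one₀ h0.le h1.le)
  have hmaj := (hasSum_succ_mul_pow h0.le h1).mul_right L
  have hsum := Summable.of_nonneg_of_le hnonneg hle hmaj.summable
  refine ⟨Real.multipliable_of_summable_log hpos hsum, ?_⟩
  rw [← Real.rexp_tsum_eq_tprod hpos hsum, Real.log_exp]
  refine (hasSum_le hle hsum.hasSum hmaj).trans_lt ?_
  have hy : 0 < 1 - q := sub_pos.2 h1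
  have hLq : L * (1 - q) ≤ q := by
    have h := Real.one_sub_inv_le_log_of_pos hy
    calc L * (1 - q) ≤ ((1 - q)⁻¹ - 1) * (1 - q) := by
          gcongr
          linarith
      _ = q := by
          field_simp
          ring
  rw [one_div (1 - q), Real.log_inv, ← hL]
  have hrhs : (1 + q / (1 - q) ^ 2) * (1 + L) = (1 - q + q ^ 2) * (1 + L) / (1 - q) ^ 2 := by
    field_simp
    ring
  rw [hrhs, one_div_mul_eq_div]
  gcongr
  nlinarith [mul_le_mul_of_nonneg_left hLq h0.le]

end QT
end

section
/- For every real number q with 0 < q < 1, the sequence t_n(q) / ((1-q)^n [n]_q!) converges as n → ∞ to ∏_{i ≥ 1} (1 - q^i)^{-1} · ∏_{0 ≤ i < j} (1 - q^{i+j})^{-1}, and for real numbers 0 < p, q < 1, the sequence A_n(p,q) / ((1-p)^n (1-q)^n [n]_p! [n]_q!) converges as n → ∞ to ∏_{(i,j): i,j ≥ 0, i+j > 0} (1 - p^i q^j)^{-1}. -/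
open Finset

namespace QT

open scoped ENNReal

/-- `f` is weakly decreasing, strictly so at the descents of `σ`. -/
def Compat {n : ℕ} (σ : Equiv.Perm (Fin n)) (f : Fin n → ℕ) : Prop :=
  ∀ k l, k < l → f l ≤ f k ∧ (f k = f l → σ k < σ l)

/-- The multiset of columns of the biword with top row `f` and bottom row `g ∘ σ`. -/
def biword {n : ℕ} (σ : Equiv.Perm (Fin n)) (f g : Fin n → ℕ) : Multiset (ℕ × ℕ) :=
  Finset.univ.val.map fun k => (f k, g (σ k))

theorem card_biword {n : ℕ} (σ : Equiv.Perm (Fin n)) (f g : Fin n → ℕ) :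
    (biword σ f g).card = n := by
  simp [biword]

theorem biword_swap {n : ℕ} (σ : Equiv.Perm (Fin n)) (f g : Fin n → ℕ) :
    (biword σ f g).map Prod.swap = biword σ⁻¹ g f := by
  have h : (Finset.univ.val.map fun k => (g (σ k), f k)) =
      (Finset.univ.val.map σ).map fun k => (g k, f (σ⁻¹ k)) := by
    rw [Multiset.map_map]
    simp
  have h2 : Finset.univ.val.map σ = (Finset.univ : Finset (Fin n)).val := by
    exact congrArg Finset.val (Finset.map_univ_equiv σ)
  rw [h2] at h
  rw [biword, Multiset.map_map]
  exact h

theorem antitone_of_compat {n : ℕ} {σ : Equiv.Perm (Fin n)} {f g : Fin n → ℕ}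
    (hf : Compat σ f) (hg : Compat σ⁻¹ g) :
    Antitone fun k => toLex (f k, g (σ k)) := by
  rw [antitone_iff_forall_lt]
  intro k l hkl
  rw [Prod.Lex.toLex_le_toLex]
  obtain ⟨h1, h2⟩ := hf k l hkl
  rcases h1.lt_or_eq with h | h
  · exact Or.inl h
  · exact Or.inr ⟨h, (hg _ _ (h2 h.symm)).1⟩

theorem inv_eq_sort_of_compat {n : ℕ} {σ : Equiv.Perm (Fin n)} {g : Fin n → ℕ}
    (hg : Compat σ⁻¹ g) : σ⁻¹ = Tuple.sort fun k => OrderDual.toDual (g (σ k)) := by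
  rw [Tuple.eq_sort_iff]
  refine ⟨?_, fun i j hij h => (hg i j hij).2 (by simpa using h)⟩
  rw [monotone_iff_forall_lt]
  intro i j hij
  simpa using (hg i j hij).1

theorem biword_injective {n : ℕ} {σ τ : Equiv.Perm (Fin n)} {f g f' g' : Fin n → ℕ}
    (hf : Compat σ f) (hg : Compat σ⁻¹ g) (hf' : Compat τ f') (hg' : Compat τ⁻¹ g')
    (h : biword σ f g = biword τ f' g') : σ = τ ∧ f = f' ∧ g = g' := by
  have key : (fun k => toLex (f k, g (σ k))) = fun k => toLex (f' k, g' (τ k)) := by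
    apply List.ofFn_injective
    refine List.Perm.eq_of_sortedGE (antitone_of_compat hf hg).sortedGE_ofFn
      (antitone_of_compat hf' hg').sortedGE_ofFn ?_
    rw [← Multiset.coe_eq_coe, ← Fin.univ_val_map, ← Fin.univ_val_map]
    simpa only [biword, Multiset.map_map, Function.comp_def] using congrArg (Multiset.map toLex) h
  have hk : ∀ k, f k = f' k ∧ g (σ k) = g' (τ k) := fun k => by
    simpa using congrFun key k
  have hσ : σ = τ := by
    apply inv_injective
    rw [inv_eq_sort_of_compat hg, inv_eq_sort_of_compat hg']
    simp only [(hk _).2]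
  subst hσ
  refine ⟨rfl, funext fun k => (hk k).1, funext fun k => ?_⟩
  simpa using (hk (σ⁻¹ k)).2

theorem exists_biword {n : ℕ} (M : Multiset (ℕ × ℕ)) (hM : M.card = n) :
    ∃ (σ : Equiv.Perm (Fin n)) (f g : Fin n → ℕ),
      Compat σ f ∧ Compat σ⁻¹ g ∧ biword σ f g = M := by
  obtain ⟨w, hw, hwM⟩ : ∃ w : Fin n → ℕ ×ₗ ℕ, Antitone w ∧
      Finset.univ.val.map w = M.map toLex := by
    have hlen : ((M.map toLex).sort (· ≥ ·)).length = n := by simp [hM]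
    subst hlen
    refine ⟨((M.map toLex).sort (· ≥ ·)).get, ?_, ?_⟩
    · exact List.SortedGE.antitone_get (Multiset.pairwise_sort _ _).sortedGE
    · rw [Fin.univ_val_map, List.ofFn_get, Multiset.sort_eq]
  set τ := Tuple.sort fun k => OrderDual.toDual (ofLex (w k)).2 with hτ
  obtain ⟨h1, h2⟩ := Tuple.eq_sort_iff.1 hτ
  have hanti : ∀ k l, k < l → (ofLex (w (τ l))).2 ≤ (ofLex (w (τ k))).2 :=
    fun k l hkl => h1 hkl.le
  refine ⟨τ⁻¹, fun k => (ofLex (w k)).1, fun k => (ofLex (w (τ k))).2, ?_, ?_, ?_⟩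
  · intro k l hkl
    have h := hw hkl.le
    rw [Prod.Lex.le_iff] at h
    refine ⟨h.elim (fun h => h.le) fun h => h.1.le, fun he => ?_⟩
    dsimp only at he
    have hle : (ofLex (w l)).2 ≤ (ofLex (w k)).2 := by
      rcases h with h | h
      · omega
      · exact h.2
    by_contra hlt
    rcases (not_lt.1 hlt).lt_or_eq with hlt | heq
    · have h3 := hanti _ _ hlt
      simp only [Equiv.Perm.coe_inv, Equiv.apply_symm_apply] at h3
      have h4 := h2 _ _ hlt (by simpa using congrArg OrderDual.toDual (hle.antisymm h3))
      simp only [Equiv.Perm.coe_inv, Equiv.apply_symm_apply] at h4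
      exact absurd h4 hkl.not_gt
    · exact hkl.ne' (τ⁻¹.injective heq)
  · intro k l hkl
    refine ⟨hanti k l hkl, fun he => ?_⟩
    simpa using h2 k l hkl (congrArg OrderDual.toDual he)
  · have := congrArg (Multiset.map ofLex) hwM
    simpa [biword, Multiset.map_map, Function.comp_def] using this

/-- The value of `f` at the next index, and `0` past the end. -/
def next {n : ℕ} (f : Fin n → ℕ) (k : Fin n) : ℕ :=
  if h : (k : ℕ) + 1 < n then f ⟨k + 1, h⟩ else 0

/-- The indicator function of the descents of `σ`. -/
def desc {n : ℕ} (σ : Equiv.Perm (Fin n)) (k : Fin n) : ℕ :=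
  if h : (k : ℕ) + 1 < n then (if σ ⟨k + 1, h⟩ < σ k then 1 else 0) else 0

theorem maj_eq_sum_desc {n : ℕ} (σ : Equiv.Perm (Fin n)) :
    maj σ = ∑ k : Fin n, ((k : ℕ) + 1) * desc σ k := by
  rw [maj, Finset.sum_range]
  refine Finset.sum_congr rfl fun k _ => ?_
  unfold desc
  split_ifs <;> simp

theorem compat_iff {n : ℕ} (σ : Equiv.Perm (Fin n)) (f : Fin n → ℕ) :
    Compat σ f ↔ ∀ k, next f k + desc σ k ≤ f k := by
  constructor
  · intro hf k
    unfold next desc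
    split_ifs with h hd
    · obtain ⟨h1, h2⟩ := hf k ⟨k + 1, h⟩ (Fin.lt_def.2 (Nat.lt_succ_self _))
      rcases h1.lt_or_eq with h3 | h3
      · exact h3
      · exact absurd (h2 h3.symm) hd.not_gt
    · exact (hf k ⟨k + 1, h⟩ (Fin.lt_def.2 (Nat.lt_succ_self _))).1
    · exact Nat.zero_le _
  · intro hf
    have step : ∀ (d : ℕ) (k : Fin n) (h : (k : ℕ) + (d + 1) < n),
        f ⟨k + (d + 1), h⟩ ≤ f k ∧ (f k = f ⟨k + (d + 1), h⟩ → σ k < σ ⟨k + (d + 1), h⟩) := by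
      have one : ∀ (k : Fin n) (h : (k : ℕ) + 1 < n),
          f ⟨k + 1, h⟩ ≤ f k ∧ (f k = f ⟨k + 1, h⟩ → σ k < σ ⟨k + 1, h⟩) := by
        intro k h
        have h1 := hf k
        simp only [next, desc, h, dif_pos] at h1
        refine ⟨by omega, fun he => ?_⟩
        split_ifs at h1 with hd
        · omega
        · refine lt_of_le_of_ne (not_lt.1 hd) fun h2 => ?_
          have := congrArg Fin.val (σ.injective h2)
          simp at this
      intro d
      induction d with
      | zero => exact one
      | succ d ih =>
        intro k h
        obtain ⟨h1, h2⟩ := ih k (by omega)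
        obtain ⟨h3, h4⟩ := one ⟨k + (d + 1), by omega⟩ h
        exact ⟨h3.trans h1, fun he => (h2 (h1.antisymm' (he.trans_le h3))).trans
          (h4 (h3.antisymm' (h1.trans_eq he)))⟩
    intro k l hkl
    obtain ⟨d, hd⟩ := Nat.exists_eq_add_of_lt (Fin.lt_def.1 hkl)
    have hl : l = ⟨k + (d + 1), by omega⟩ := Fin.ext hd
    rw [hl]
    exact step d k _

/-- The tail sums of `e`. -/
def tailSum {n : ℕ} (e : Fin n → ℕ) (k : Fin n) : ℕ := ∑ l ∈ Finset.Ici k, e l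

theorem tailSum_eq {n : ℕ} (e : Fin n → ℕ) (k : Fin n) :
    tailSum e k = next (tailSum e) k + e k := by
  have h : Finset.Ici k = insert k (Finset.Ioi k) := by simp
  rw [tailSum, h, Finset.sum_insert (by simp), add_comm]
  congr 1
  unfold next
  split_ifs with hk
  · rw [tailSum]
    congr 1
    ext l
    simp only [Finset.mem_Ioi, Finset.mem_Ici, Fin.lt_def, Fin.le_def]
    omega
  · apply Finset.sum_eq_zero
    intro l hl
    have := Fin.lt_def.1 (Finset.mem_Ioi.1 hl)
    omega

theorem eq_tailSum {n : ℕ} {f e : Fin n → ℕ} (h : ∀ k, f k = next f k + e k) :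
    f = tailSum e := by
  have key : ∀ (d : ℕ) (k : Fin n), n - (k : ℕ) = d → f k = tailSum e k := by
    intro d
    induction d with
    | zero => intro k hk; omega
    | succ d ih =>
      intro k hk
      rw [h, tailSum_eq]
      congr 1
      unfold next
      split_ifs with h1
      · exact ih _ (by simp; omega)
      · rfl
  exact funext fun k => key _ k rfl

theorem sum_tailSum {n : ℕ} (e : Fin n → ℕ) :
    ∑ k, tailSum e k = ∑ k : Fin n, ((k : ℕ) + 1) * e k := by
  simp only [tailSum]
  rw [Finset.sum_comm' (t' := Finset.univ) (s' := fun l => Finset.Iic l) (by simp)]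
  simp

/-- Sequences compatible with `σ` are parametrized by their excess differences. -/
noncomputable def compatEquiv {n : ℕ} (σ : Equiv.Perm (Fin n)) :
    (Fin n → ℕ) ≃ {f : Fin n → ℕ // Compat σ f} where
  toFun d := ⟨tailSum fun k => d k + desc σ k, (compat_iff _ _).2 fun k => by
    rw [tailSum_eq _ k]; omega⟩
  invFun f k := f.1 k - next f.1 k - desc σ k
  left_inv d := by
    funext k
    have := tailSum_eq (fun k => d k + desc σ k) k
    dsimp only
    omega
  right_inv f := by
    apply Subtype.ext
    symm
    apply eq_tailSum
    intro k
    have := (compat_iff _ _).1 f.2 k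
    dsimp only
    omega

theorem tsum_fin_prod (n : ℕ) (g : Fin n → ℕ → ℝ≥0∞) :
    ∑' f : Fin n → ℕ, ∏ k, g k (f k) = ∏ k, ∑' m, g k m := by
  induction n with
  | zero => simp
  | succ n ih =>
    rw [← (Fin.consEquiv fun _ => ℕ).tsum_eq, ENNReal.tsum_prod', Fin.prod_univ_succ, ← ih,
      ← ENNReal.tsum_mul_right]
    refine tsum_congr fun m => ?_
    rw [← ENNReal.tsum_mul_left]
    refine tsum_congr fun f => ?_
    simp [Fin.prod_univ_succ, Fin.consEquiv]

theorem tsum_pi_prod {ι : Type*} [Fintype ι] (g : ι → ℕ → ℝ≥0∞) :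
    ∑' f : ι → ℕ, ∏ k, g k (f k) = ∏ k, ∑' m, g k m := by
  let e := Fintype.equivFin ι
  rw [← (e.arrowCongr (Equiv.refl ℕ)).symm.tsum_eq, ← e.symm.prod_comp, ← tsum_fin_prod]
  refine tsum_congr fun f => ?_
  rw [← e.symm.prod_comp]
  simp

theorem tsum_compat {n : ℕ} (σ : Equiv.Perm (Fin n)) (q : ℝ≥0∞) :
    ∑' f : {f : Fin n → ℕ // Compat σ f}, q ^ ∑ k, f.1 k =
      q ^ maj σ * ∏ k : Fin n, (1 - q ^ ((k : ℕ) + 1))⁻¹ := by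
  rw [← (compatEquiv σ).tsum_eq]
  have h : ∀ d : Fin n → ℕ, q ^ ∑ k, (compatEquiv σ d).1 k =
      q ^ maj σ * ∏ k : Fin n, (q ^ ((k : ℕ) + 1)) ^ d k := by
    intro d
    have : ∑ k, (compatEquiv σ d).1 k = maj σ + ∑ k : Fin n, ((k : ℕ) + 1) * d k := by
      refine (sum_tailSum _).trans ?_
      rw [maj_eq_sum_desc, ← Finset.sum_add_distrib]
      exact Finset.sum_congr rfl fun k _ => by ring
    rw [this, pow_add, ← Finset.prod_pow_eq_pow_sum]
    simp only [pow_mul]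
  simp only [h]
  rw [ENNReal.tsum_mul_left, tsum_pi_prod fun (k : Fin n) m => (q ^ ((k : ℕ) + 1)) ^ m]
  simp only [ENNReal.tsum_geometric]

/-- The multiset of size `n` obtained by taking `f k` copies of each block `v k` and padding
with copies of `z`. -/
def assemble {α κ : Type*} (z : α) (v : κ → Multiset α) (n : ℕ) (f : κ →₀ ℕ) : Multiset α :=
  (f.sum fun k m => m • v k) + Multiset.replicate (n - f.sum fun k m => m * (v k).card) z

theorem card_assemble {α κ : Type*} (z : α) (v : κ → Multiset α) {n : ℕ} {f : κ →₀ ℕ}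
    (h : (f.sum fun k m => m * (v k).card) ≤ n) : (assemble z v n f).card = n := by
  have : (f.sum fun k m => m • v k).card = f.sum fun k m => m * (v k).card := by
    simp [Finsupp.sum]
  rw [assemble, Multiset.card_add, this, Multiset.card_replicate]
  omega

theorem count_sum_smul {α κ : Type*} [DecidableEq α] [DecidableEq κ]
    (v : κ → Multiset α) (key : κ → α)
    (hkey : ∀ k l, (v l).count (key k) = if l = k then 1 else 0) (f : κ →₀ ℕ) (k : κ) :
    (f.sum fun k m => m • v k).count (key k) = f k := by
  simp [Finsupp.sum, Multiset.count_sum', hkey, eq_comm]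

theorem prod_map_assemble {α κ : Type*} (z : α) (v : κ → Multiset α) (n : ℕ) (f : κ →₀ ℕ)
    (x : α → ℝ≥0∞) (hx : x z = 1) :
    ((assemble z v n f).map x).prod = f.prod fun k m => ((v k).map x).prod ^ m := by
  have h : (f.sum fun k m => m • v k).map x = f.sum fun k m => m • (v k).map x := by
    simp only [Finsupp.sum, ← Multiset.coe_mapAddMonoidHom, map_sum, map_nsmul]
  rw [assemble, Multiset.map_add, h]
  simp [Finsupp.sum, Finsupp.prod, Multiset.prod_sum, Multiset.prod_nsmul, hx]

/-- Multisets of size `n` in a submonoid freely generated by blocks `v k` together with `{z}`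
are parametrized by block multiplicities of total size at most `n`. -/
theorem tsum_multiset {α κ : Type*} [DecidableEq α] [DecidableEq κ] (z : α)
    (C : AddSubmonoid (Multiset α)) (v : κ → Multiset α) (key : κ → α)
    (hvC : ∀ k, v k ∈ C) (hzC : {z} ∈ C) (hz : ∀ k, z ∉ v k) (hkz : ∀ k, key k ≠ z)
    (hkey : ∀ k l, (v l).count (key k) = if l = k then 1 else 0)
    (hC : ∀ M ∈ C, ∀ N ∈ C, (∀ k, M.count (key k) = N.count (key k)) →
      ∀ y, y ≠ z → M.count y = N.count y)
    (x : α → ℝ≥0∞) (hx : x z = 1) (n : ℕ) :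
    ∑' M : {M : Multiset α // M ∈ C ∧ M.card = n}, (M.1.map x).prod =
      ∑' f : {f : κ →₀ ℕ // (f.sum fun k m => m * (v k).card) ≤ n},
        f.1.prod fun k m => ((v k).map x).prod ^ m := by
  have hsumC : ∀ f : κ →₀ ℕ, (f.sum fun k m => m • v k) ∈ C := fun f =>
    AddSubmonoid.sum_mem _ fun k _ => AddSubmonoid.nsmul_mem _ (hvC k) _
  have hcount : ∀ (f : κ →₀ ℕ) (k : κ), (assemble z v n f).count (key k) = f k := by
    intro f k
    rw [assemble, Multiset.count_add, count_sum_smul v key hkey,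
      Multiset.count_replicate, if_neg (hkz k).symm, add_zero]
  let F : {f : κ →₀ ℕ // (f.sum fun k m => m * (v k).card) ≤ n} →
      {M : Multiset α // M ∈ C ∧ M.card = n} := fun f =>
    ⟨assemble z v n f.1, AddSubmonoid.add_mem _ (hsumC _) (by
      rw [← Multiset.nsmul_singleton]; exact AddSubmonoid.nsmul_mem _ hzC _),
      card_assemble z v f.2⟩
  have hF : Function.Bijective F := by
    constructor
    · intro f g h
      have h' : assemble z v n f.1 = assemble z v n g.1 := congrArg Subtype.val h
      apply Subtype.ext
      ext k
      rw [← hcount f.1 k, h', hcount]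
    · rintro ⟨M, hMC, hMn⟩
      have hinj : Function.Injective key := by
        intro k l h
        by_contra hne
        have h1 := hkey k l
        rw [h, hkey l l, if_pos rfl, if_neg (Ne.symm hne)] at h1
        exact one_ne_zero h1
      let f : κ →₀ ℕ := (Multiset.toFinsupp M).comapDomain key hinj.injOn
      set N := f.sum fun k m => m • v k with hN
      have hNM : ∀ y, y ≠ z → N.count y = M.count y :=
        hC _ (hsumC f) _ hMC fun k => by rw [count_sum_smul v key hkey]; simp [f]
      have hNz : N.count z = 0 := by
        simp [hN, Finsupp.sum, Multiset.count_sum', Multiset.count_eq_zero.2 (hz _)]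
      have hle : N ≤ M := by
        rw [Multiset.le_iff_count]
        intro y
        by_cases hy : y = z
        · rw [hy, hNz]; exact Nat.zero_le _
        · exact (hNM y hy).le
      have hcard : (f.sum fun k m => m * (v k).card) ≤ n := by
        rw [← hMn]
        refine le_trans (le_of_eq ?_) (Multiset.card_le_card hle)
        simp [hN, Finsupp.sum]
      refine ⟨⟨f, hcard⟩, Subtype.ext ?_⟩
      have hy : ∀ y, y ≠ z → (assemble z v n f).count y = M.count y := fun y hy => by
        rw [assemble, Multiset.count_add, Multiset.count_replicate, if_neg (Ne.symm hy), add_zero]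
        exact hNM y hy
      have hfilter : (assemble z v n f).filter (· ≠ z) = M.filter (· ≠ z) := by
        ext y
        by_cases h : y = z
        · simp [h]
        · simp [h, hy y h]
      have hsplit : ∀ M' : Multiset α, M'.card = M'.count z + (M'.filter (· ≠ z)).card := by
        intro M'
        rw [← Multiset.card_replicate (M'.count z) z, ← Multiset.filter_eq',
          ← Multiset.card_add, Multiset.filter_add_not]
      ext y
      by_cases h : y = z
      · have h1 := hsplit (assemble z v n f)
        have h2 := hsplit M
        rw [card_assemble z v hcard, hfilter] at h1
        change (assemble z v n f).count y = M.count y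
        rw [h]
        omega
      · exact hy y h
  rw [← (Equiv.ofBijective F hF).tsum_eq]
  refine tsum_congr fun f => ?_
  exact prod_map_assemble z v n f.1 x hx

theorem tendsto_tsum_le {β : Type*} (deg : β → ℕ) (W : β → ℝ≥0∞) :
    Filter.Tendsto (fun n : ℕ => ∑' f : {f : β // deg f ≤ n}, W f.1) Filter.atTop
      (nhds (∑' f, W f)) := by
  have h1 : ∑' f, W f = ⨆ n : ℕ, ∑' f : {f : β // deg f ≤ n}, W f.1 := by
    apply le_antisymm
    · rw [ENNReal.tsum_eq_iSup_sum]
      refine iSup_le fun s => le_iSup_of_le (s.sup deg) ?_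
      calc ∑ f ∈ s, W f = ∑' f : (s : Set β), W f := (Finset.tsum_subtype' s W).symm
        _ ≤ _ := ENNReal.tsum_mono_subtype W
            (s := (s : Set β)) (t := {f | deg f ≤ s.sup deg}) fun f hf =>
              Finset.le_sup (f := deg) hf
    · exact iSup_le fun n => ENNReal.tsum_comp_le_tsum_of_injective Subtype.val_injective _
  rw [h1]
  refine tendsto_atTop_iSup fun m n hmn => ?_
  exact ENNReal.tsum_mono_subtype W (s := {f | deg f ≤ m}) (t := {f | deg f ≤ n})
    fun f hf => le_trans hf hmn

theorem tsum_finsupp_supported {κ : Type*} [DecidableEq κ] (y : κ → ℝ≥0∞) (s : Finset κ) :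
    ∑' f : {f : κ →₀ ℕ // f.support ⊆ s}, f.1.prod (fun k m => y k ^ m) =
      ∏ k ∈ s, (1 - y k)⁻¹ := by
  have h : ∀ f : {f : κ →₀ ℕ // f.support ⊆ s}, f.1.prod (fun k m => y k ^ m) =
      ∏ k : s, y k ^ f.1 k := fun f => by
    rw [Finsupp.prod_of_support_subset _ f.2 _ (by simp), ← Finset.prod_coe_sort]
  simp only [h, ← ENNReal.tsum_geometric]
  rw [← Finset.prod_coe_sort, ← tsum_pi_prod fun (k : s) m => y k ^ m]
  let e : {f : κ →₀ ℕ // f.support ⊆ s} ≃ (s → ℕ) :=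
    { toFun := fun f k => f.1 k
      invFun := fun g => ⟨Finsupp.onFinset s (fun k => if h : k ∈ s then g ⟨k, h⟩ else 0)
        (fun k hk => by by_contra h; simp [h] at hk), Finsupp.support_onFinset_subset⟩
      left_inv := fun f => by
        ext k
        by_cases hk : k ∈ s
        · simp [hk]
        · simpa [hk] using (Finsupp.notMem_support_iff.1 fun h => hk (f.2 h)).symm
      right_inv := fun g => by
        funext k
        simp }
  exact e.tsum_eq fun g : s → ℕ => ∏ k : s, y k ^ g k

theorem tsum_finsupp_prod {κ : Type*} (y : κ → ℝ≥0∞) :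
    ∑' f : κ →₀ ℕ, f.prod (fun k m => y k ^ m) = ⨆ s : Finset κ, ∏ k ∈ s, (1 - y k)⁻¹ := by
  classical
  simp only [← tsum_finsupp_supported]
  apply le_antisymm
  · rw [ENNReal.tsum_eq_iSup_sum]
    refine iSup_le fun s => le_iSup_of_le (s.sup Finsupp.support) ?_
    rw [← Finset.tsum_subtype']
    exact ENNReal.tsum_mono_subtype (fun f : κ →₀ ℕ => f.prod fun k m => y k ^ m)
      (s := (s : Set (κ →₀ ℕ))) (t := {f | f.support ⊆ s.sup Finsupp.support})
      fun f hf => Finset.le_sup (f := Finsupp.support) hf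
  · exact iSup_le fun s => ENNReal.tsum_comp_le_tsum_of_injective Subtype.val_injective
      fun f : κ →₀ ℕ => f.prod fun k m => y k ^ m

theorem multipliable_inv_one_sub {κ : Type*} {x : κ → ℝ} (h0 : ∀ k, 0 ≤ x k)
    (h1 : ∀ k, x k < 1) (hx : Summable x) : Multipliable fun k => (1 - x k)⁻¹ := by
  have h : Summable fun k => x k / (1 - x k) := by
    refine Summable.of_norm_bounded_eventually (g := fun k => 2 * x k) (hx.mul_left 2) ?_
    filter_upwards [hx.tendsto_cofinite_zero.eventually_lt_const (show (0 : ℝ) < 1 / 2 by norm_num)]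
      with k hk
    have := h1 k
    rw [Real.norm_of_nonneg (div_nonneg (h0 k) (by linarith)), div_le_iff₀ (by linarith)]
    nlinarith [h0 k]
  refine (Real.multipliable_one_add_of_summable h).congr fun k => ?_
  have := h1 k
  have h2 : 1 - x k ≠ 0 := by linarith
  field_simp
  ring

theorem tsum_finsupp_prod_ofReal {κ : Type*} {x : κ → ℝ} (h0 : ∀ k, 0 ≤ x k)
    (h1 : ∀ k, x k < 1) {P : ℝ} (hP : HasProd (fun k => (1 - x k)⁻¹) P) :
    ∑' f : κ →₀ ℕ, f.prod (fun k m => ENNReal.ofReal (x k) ^ m) = ENNReal.ofReal P := by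
  classical
  have h : ∀ k, (1 - ENNReal.ofReal (x k))⁻¹ = ENNReal.ofReal (1 - x k)⁻¹ := fun k => by
    have := h1 k
    rw [ENNReal.ofReal_inv_of_pos (by linarith), ENNReal.ofReal_sub _ (h0 k), ENNReal.ofReal_one]
  have hcomp : (fun s : Finset κ => ∏ k ∈ s, (1 - ENNReal.ofReal (x k))⁻¹) =
      fun s => ENNReal.ofReal (∏ k ∈ s, (1 - x k)⁻¹) := by
    funext s
    rw [ENNReal.ofReal_prod_of_nonneg fun k _ => inv_nonneg.2 (sub_nonneg.2 (h1 k).le)]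
    exact Finset.prod_congr rfl fun k _ => h k
  rw [tsum_finsupp_prod]
  refine tendsto_nhds_unique (tendsto_atTop_iSup ?_) (hcomp ▸ ENNReal.tendsto_ofReal hP)
  intro s t hst
  refine Finset.prod_le_prod_of_subset_of_one_le' hst fun k _ _ => ?_
  exact ENNReal.one_le_inv.2 tsub_le_self

theorem tsum_biword {n : ℕ} (p q : ℝ≥0∞) :
    ∑' M : {M : Multiset (ℕ × ℕ) // M ∈ (⊤ : AddSubmonoid (Multiset (ℕ × ℕ))) ∧ M.card = n},
        (M.1.map fun y => p ^ y.1 * q ^ y.2).prod =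
      (∑ π : Equiv.Perm (Fin n), p ^ imaj π * q ^ maj π) *
        ((∏ k : Fin n, (1 - p ^ ((k : ℕ) + 1))⁻¹) * ∏ k : Fin n, (1 - q ^ ((k : ℕ) + 1))⁻¹) := by
  let F : (Σ σ : Equiv.Perm (Fin n), {f : Fin n → ℕ // Compat σ f} ×
      {g : Fin n → ℕ // Compat σ⁻¹ g}) →
      {M : Multiset (ℕ × ℕ) // M ∈ (⊤ : AddSubmonoid (Multiset (ℕ × ℕ))) ∧ M.card = n} :=
    fun t => ⟨biword t.1 t.2.1 t.2.2, trivial, card_biword _ _ _⟩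
  have hF : Function.Bijective F := by
    constructor
    · rintro ⟨σ, ⟨f, hf⟩, ⟨g, hg⟩⟩ ⟨τ, ⟨f', hf'⟩, ⟨g', hg'⟩⟩ h
      obtain ⟨rfl, rfl, rfl⟩ := biword_injective hf hg hf' hg' (congrArg Subtype.val h)
      rfl
    · rintro ⟨M, _, hM⟩
      obtain ⟨σ, f, g, hf, hg, h⟩ := exists_biword M hM
      exact ⟨⟨σ, ⟨f, hf⟩, ⟨g, hg⟩⟩, Subtype.ext h⟩
  have hwt : ∀ t, ((F t).1.map fun y => p ^ y.1 * q ^ y.2).prod =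
      (p ^ ∑ k, t.2.1.1 k) * q ^ ∑ k, t.2.2.1 k := by
    rintro ⟨σ, f, g⟩
    have h : ((F ⟨σ, f, g⟩).1.map fun y => p ^ y.1 * q ^ y.2).prod =
        ∏ k, p ^ f.1 k * q ^ g.1 (σ k) := by
      simp only [F, biword, Multiset.map_map, Function.comp_def, Finset.prod]
    rw [h, Finset.prod_mul_distrib, Finset.prod_pow_eq_pow_sum, Finset.prod_pow_eq_pow_sum,
      Equiv.sum_comp σ g.1]
  rw [← (Equiv.ofBijective F hF).tsum_eq]
  simp only [Equiv.ofBijective_apply, hwt]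
  rw [ENNReal.tsum_sigma', tsum_fintype, Finset.sum_mul, ← Equiv.sum_comp (Equiv.inv _)]
  refine Finset.sum_congr rfl fun π _ => ?_
  rw [ENNReal.tsum_prod']
  simp only [ENNReal.tsum_mul_left, ENNReal.tsum_mul_right, tsum_compat, Equiv.inv_apply, inv_inv,
    imaj]
  ring

/-- The multisets of pairs invariant under exchanging the coordinates. -/
def symmMultisets : AddSubmonoid (Multiset (ℕ × ℕ)) where
  carrier := {M | M.map Prod.swap = M}
  zero_mem' := by simp
  add_mem' {M N} hM hN := by
    change (M + N).map Prod.swap = M + N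
    rw [Multiset.map_add, show M.map Prod.swap = M from hM, show N.map Prod.swap = N from hN]

theorem tsum_biword_symm {n : ℕ} (q : ℝ≥0∞) :
    ∑' M : {M : Multiset (ℕ × ℕ) // M ∈ symmMultisets ∧ M.card = n},
        (M.1.map fun y => q ^ y.1).prod =
      (∑ π ∈ involutions n, q ^ maj π) * ∏ k : Fin n, (1 - q ^ ((k : ℕ) + 1))⁻¹ := by
  have hinv : ∀ σ : involutions n, σ.1⁻¹ = σ.1 := fun σ =>
    inv_eq_of_mul_eq_one_left (Finset.mem_filter.1 σ.2).2
  let F : (Σ σ : involutions n, {f : Fin n → ℕ // Compat σ.1 f}) →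
      {M : Multiset (ℕ × ℕ) // M ∈ symmMultisets ∧ M.card = n} :=
    fun t => ⟨biword t.1 t.2.1 t.2.1, (biword_swap _ _ _).trans (by rw [hinv]),
      card_biword _ _ _⟩
  have hF : Function.Bijective F := by
    constructor
    · rintro ⟨⟨σ, hσ⟩, ⟨f, hf⟩⟩ ⟨⟨τ, hτ⟩, ⟨f', hf'⟩⟩ h
      obtain ⟨rfl, rfl, -⟩ := biword_injective hf ((hinv ⟨σ, hσ⟩).symm ▸ hf) hf'
        ((hinv ⟨τ, hτ⟩).symm ▸ hf') (congrArg Subtype.val h)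
      rfl
    · rintro ⟨M, hsymm, hM⟩
      obtain ⟨σ, f, g, hf, hg, h⟩ := exists_biword M hM
      have h2 : biword σ f g = biword σ⁻¹ g f := by
        rw [← biword_swap, h]
        exact hsymm.symm
      obtain ⟨hσ, rfl, -⟩ := biword_injective hf hg hg (by rwa [inv_inv]) h2
      refine ⟨⟨⟨σ, Finset.mem_filter.2 ⟨Finset.mem_univ _, ?_⟩⟩, ⟨f, hf⟩⟩, Subtype.ext h⟩
      nth_rewrite 1 [hσ]
      exact inv_mul_cancel σ
  have hwt : ∀ t, ((F t).1.map fun y => q ^ y.1).prod = q ^ ∑ k, t.2.1 k := by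
    rintro ⟨σ, f⟩
    rw [← Finset.prod_pow_eq_pow_sum]
    simp only [F, biword, Multiset.map_map, Function.comp_def, Finset.prod]
  rw [← (Equiv.ofBijective F hF).tsum_eq]
  simp only [Equiv.ofBijective_apply, hwt]
  rw [ENNReal.tsum_sigma', tsum_fintype, Finset.sum_mul]
  exact (Finset.sum_congr rfl fun (σ : involutions n) _ => tsum_compat σ.1 q).trans
    (Finset.sum_coe_sort (involutions n) fun σ => q ^ maj σ * _)

/-- The generating function of a submonoid of multisets freely generated by blocks `v k` together
with `{z}` converges to the product over the blocks. -/
theorem tendsto_tsum_multiset {α κ : Type*} [DecidableEq α] [DecidableEq κ] (z : α)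
    (C : AddSubmonoid (Multiset α)) (v : κ → Multiset α) (key : κ → α)
    (hvC : ∀ k, v k ∈ C) (hzC : {z} ∈ C) (hz : ∀ k, z ∉ v k) (hkz : ∀ k, key k ≠ z)
    (hkey : ∀ k l, (v l).count (key k) = if l = k then 1 else 0)
    (hC : ∀ M ∈ C, ∀ N ∈ C, (∀ k, M.count (key k) = N.count (key k)) →
      ∀ y, y ≠ z → M.count y = N.count y)
    (w : α → ℝ≥0∞) (hw : w z = 1) {x : κ → ℝ} (h0 : ∀ k, 0 ≤ x k)
    (h1 : ∀ k, x k < 1) (hwx : ∀ k, ((v k).map w).prod = ENNReal.ofReal (x k))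
    {P : ℝ} (hP : HasProd (fun k => (1 - x k)⁻¹) P) :
    Filter.Tendsto (fun n : ℕ => (∑' M : {M : Multiset α // M ∈ C ∧ M.card = n},
      (M.1.map w).prod).toReal) Filter.atTop (nhds P) := by
  have hnonneg : 0 ≤ P := by
    refine ge_of_tendsto' hP fun s => Finset.prod_nonneg fun k _ => ?_
    exact inv_nonneg.2 (sub_nonneg.2 (h1 k).le)
  rw [← ENNReal.toReal_ofReal hnonneg]
  refine (ENNReal.tendsto_toReal ENNReal.ofReal_ne_top).comp ?_
  rw [← tsum_finsupp_prod_ofReal h0 h1 hP]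
  simp only [tsum_multiset z C v key hvC hzC hz hkz hkey hC w hw, hwx]
  exact tendsto_tsum_le (fun f : κ →₀ ℕ => f.sum fun k m => m * (v k).card)
    fun f => f.prod fun k m => ENNReal.ofReal (x k) ^ m

theorem toReal_prod_inv {q : ℝ} (hq0 : 0 < q) (hq1 : q < 1) (n : ℕ) :
    (∏ k : Fin n, (1 - ENNReal.ofReal q ^ ((k : ℕ) + 1))⁻¹).toReal =
      ((1 - q) ^ n * qFact q n)⁻¹ := by
  have h : (1 - q) ^ n * qFact q n = ∏ k : Fin n, (1 - q ^ ((k : ℕ) + 1)) := by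
    have hconst : (1 - q) ^ n = ∏ _k : Fin n, (1 - q) := by simp
    rw [qFact, Finset.prod_range, hconst, ← Finset.prod_mul_distrib]
    exact Finset.prod_congr rfl fun k _ => mul_neg_geom_sum q _
  rw [h, ENNReal.toReal_prod, ← Finset.prod_inv_distrib]
  refine Finset.prod_congr rfl fun k _ => ?_
  rw [ENNReal.toReal_inv, ← ENNReal.ofReal_pow hq0.le, ← ENNReal.ofReal_one,
    ← ENNReal.ofReal_sub _ (by positivity),
    ENNReal.toReal_ofReal (sub_nonneg.2 (pow_le_one₀ hq0.le hq1.le))]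

theorem tendsto_Apq {p q : ℝ} (hp0 : 0 < p) (hp1 : p < 1) (hq0 : 0 < q) (hq1 : q < 1) :
    Filter.Tendsto (fun n : ℕ =>
        Apq p q n / ((1 - p) ^ n * (1 - q) ^ n * (qFact p n * qFact q n))) Filter.atTop
      (nhds (∏' x : {y : ℕ × ℕ // 0 < y.1 + y.2},
        (1 - p ^ (x : ℕ × ℕ).1 * q ^ (x : ℕ × ℕ).2)⁻¹)) := by
  have h0 : ∀ y : {y : ℕ × ℕ // 0 < y.1 + y.2}, 0 ≤ p ^ y.1.1 * q ^ y.1.2 :=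
    fun y => by positivity
  have h1 : ∀ y : {y : ℕ × ℕ // 0 < y.1 + y.2}, p ^ y.1.1 * q ^ y.1.2 < 1 := by
    rintro ⟨⟨i, j⟩, h⟩
    have hi : p ^ i ≤ 1 := pow_le_one₀ hp0.le hp1.le
    have hj : q ^ j ≤ 1 := pow_le_one₀ hq0.le hq1.le
    rcases Nat.eq_zero_or_pos i with rfl | hi'
    · simpa using pow_lt_one₀ hq0.le hq1 (show j ≠ 0 by rintro rfl; simp at h)
    · exact mul_lt_one_of_nonneg_of_lt_one_left (by positivity)
        (pow_lt_one₀ hp0.le hp1 hi'.ne') hj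
  have hs : Summable fun y : {y : ℕ × ℕ // 0 < y.1 + y.2} => p ^ y.1.1 * q ^ y.1.2 :=
    ((summable_geometric_of_lt_one hp0.le hp1).mul_of_nonneg
      (summable_geometric_of_lt_one hq0.le hq1) (fun _ => by positivity)
      fun _ => by positivity).subtype {y : ℕ × ℕ | 0 < y.1 + y.2}
  have key := tendsto_tsum_multiset ((0, 0) : ℕ × ℕ) ⊤
    (fun y : {y : ℕ × ℕ // 0 < y.1 + y.2} => {y.1}) Subtype.val
    (fun _ => trivial) trivial
    (fun y h => by have := y.2; rw [← Multiset.mem_singleton.1 h] at this; simp at this)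
    (fun y h => by have := y.2; rw [h] at this; simp at this)
    (fun k l => by simp [Multiset.count_singleton, Subtype.ext_iff, eq_comm])
    (fun M _ N _ h y hy => h ⟨y, by
      by_contra h2
      exact hy (Prod.ext (by simp; omega) (by simp; omega))⟩)
    (fun y => ENNReal.ofReal p ^ y.1 * ENNReal.ofReal q ^ y.2) (by simp) h0 h1
    (fun y => by
      rw [ENNReal.ofReal_mul (by positivity), ENNReal.ofReal_pow hp0.le,
        ENNReal.ofReal_pow hq0.le]
      simp)
    (multipliable_inv_one_sub h0 h1 hs).hasProd
  refine key.congr fun n => ?_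
  rw [tsum_biword, ENNReal.toReal_mul, ENNReal.toReal_mul, toReal_prod_inv hp0 hp1,
    toReal_prod_inv hq0 hq1, ENNReal.toReal_sum fun π _ => by finiteness]
  simp only [ENNReal.toReal_mul, ENNReal.toReal_pow, ENNReal.toReal_ofReal hp0.le,
    ENNReal.toReal_ofReal hq0.le]
  rw [div_eq_mul_inv, Apq, ← mul_inv]
  congr 2
  ring

theorem mem_symmMultisets {M : Multiset (ℕ × ℕ)} : M ∈ symmMultisets ↔ M.map Prod.swap = M :=
  Iff.rfl

theorem count_swap_of_mem_symm {M : Multiset (ℕ × ℕ)} (hM : M ∈ symmMultisets) (y : ℕ × ℕ) :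
    M.count y.swap = M.count y := by
  conv_lhs => rw [← mem_symmMultisets.1 hM]
  exact Multiset.count_map_eq_count' _ _ Prod.swap_injective _

/-- The representative of each orbit of the coordinate exchange on `ℕ × ℕ`, away from `(0, 0)`. -/
def orbitRep : ℕ ⊕ {y : ℕ × ℕ // y.1 < y.2} → ℕ × ℕ :=
  Sum.elim (fun i => (i + 1, i + 1)) Subtype.val

/-- The orbits of the coordinate exchange on `ℕ × ℕ`, away from `(0, 0)`. -/
def orbit : ℕ ⊕ {y : ℕ × ℕ // y.1 < y.2} → Multiset (ℕ × ℕ) :=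
  Sum.elim (fun i => {(i + 1, i + 1)}) fun y => {y.1, y.1.swap}

theorem count_orbit (k l : ℕ ⊕ {y : ℕ × ℕ // y.1 < y.2}) :
    (orbit l).count (orbitRep k) = if l = k then 1 else 0 := by
  rcases k with i | ⟨⟨a, b⟩, h⟩ <;> rcases l with j | ⟨⟨c, d⟩, h'⟩ <;>
    simp only [orbit, orbitRep, Sum.elim_inl, Sum.elim_inr, Multiset.insert_eq_cons,
      Multiset.count_cons, Multiset.count_singleton, Prod.swap, Prod.mk.injEq, Sum.inl.injEq,
      Sum.inr.injEq, Subtype.mk.injEq, reduceCtorEq] at * <;>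
    split_ifs <;> first | omega | contradiction

theorem tendsto_tq {q : ℝ} (hq0 : 0 < q) (hq1 : q < 1) :
    Filter.Tendsto (fun n : ℕ => tq q n / ((1 - q) ^ n * qFact q n)) Filter.atTop
      (nhds ((∏' i : ℕ, (1 - q ^ (i + 1))⁻¹) *
        ∏' x : {y : ℕ × ℕ // y.1 < y.2}, (1 - q ^ ((x : ℕ × ℕ).1 + (x : ℕ × ℕ).2))⁻¹)) := by
  have hs := summable_geometric_of_lt_one hq0.le hq1
  have hsum : Summable fun y : {y : ℕ × ℕ // y.1 < y.2} => q ^ (y.1.1 + y.1.2) := by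
    simp only [pow_add]
    exact (hs.mul_of_nonneg hs (fun _ => by positivity)
      fun _ => by positivity).subtype {y : ℕ × ℕ | y.1 < y.2}
  have hlt : ∀ y : {y : ℕ × ℕ // y.1 < y.2}, q ^ (y.1.1 + y.1.2) < 1 := fun y =>
    pow_lt_one₀ hq0.le hq1 (by have := y.2; omega)
  let x : ℕ ⊕ {y : ℕ × ℕ // y.1 < y.2} → ℝ :=
    Sum.elim (fun i => q ^ (i + 1)) fun y => q ^ (y.1.1 + y.1.2)
  have hP := HasProd.sum (f := fun k => (1 - x k)⁻¹)
    (multipliable_inv_one_sub (x := fun i : ℕ => q ^ (i + 1)) (fun _ => by positivity)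
      (fun i => pow_lt_one₀ hq0.le hq1 i.succ_ne_zero)
      ((summable_nat_add_iff 1).2 hs)).hasProd
    (multipliable_inv_one_sub (fun _ => by positivity) hlt hsum).hasProd
  have key := tendsto_tsum_multiset ((0, 0) : ℕ × ℕ) symmMultisets orbit orbitRep
    (by
      rintro (i | y)
      · simp [orbit, mem_symmMultisets]
      · simpa [orbit, mem_symmMultisets] using Multiset.pair_comm _ _)
    (by simp [mem_symmMultisets])
    (by
      rintro (i | ⟨⟨a, b⟩, h⟩)
      · simp [orbit]
      · simp only [orbit, Sum.elim_inr, Multiset.insert_eq_cons, Multiset.mem_cons, Multiset.mem_singleton, Prod.swap,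
          Prod.mk.injEq] at *
        omega)
    (by
      rintro (i | ⟨⟨a, b⟩, h⟩)
      · simp [orbitRep]
      · simp only [orbitRep, Sum.elim_inr, ne_eq, Prod.mk.injEq] at *
        omega)
    count_orbit
    (by
      rintro M hM N hN h ⟨a, b⟩ hy
      rcases lt_trichotomy a b with hab | rfl | hab
      · exact h (Sum.inr ⟨(a, b), hab⟩)
      · obtain ⟨i, rfl⟩ := Nat.exists_eq_succ_of_ne_zero (show a ≠ 0 by rintro rfl; exact hy rfl)
        exact h (Sum.inl i)
      · rw [← count_swap_of_mem_symm hM, ← count_swap_of_mem_symm hN]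
        exact h (Sum.inr ⟨(b, a), hab⟩))
    (fun y => ENNReal.ofReal q ^ y.1) (by simp) (x := x)
    (by rintro (i | y) <;> simp only [x, Sum.elim_inl, Sum.elim_inr] <;> positivity)
    (by
      rintro (i | y)
      · exact pow_lt_one₀ hq0.le hq1 i.succ_ne_zero
      · exact hlt y)
    (by rintro (i | y) <;> simp [x, orbit, ← ENNReal.ofReal_pow hq0.le, ← pow_add, ← ENNReal.ofReal_mul (pow_nonneg hq0.le _)])
    hP
  refine key.congr fun n => ?_
  rw [tsum_biword_symm, ENNReal.toReal_mul, toReal_prod_inv hq0 hq1,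
    ENNReal.toReal_sum fun π _ => by finiteness]
  simp only [ENNReal.toReal_pow, ENNReal.toReal_ofReal hq0.le]
  rw [div_eq_mul_inv, tq]

/-- For `0 < q < 1`,
`t_n(q)/((1-q)^n [n]_q!) → ∏_{i ≥ 1}(1-q^i)⁻¹ ∏_{0 ≤ i < j}(1-q^{i+j})⁻¹`,
and for `0 < p, q < 1`,
`A_n(p,q)/((1-p)^n (1-q)^n [n]_p! [n]_q!) → ∏_{i,j ≥ 0, i+j > 0}(1 - p^i q^j)⁻¹`. -/
theorem stmt19 (p q : ℝ) (hp0 : 0 < p) (hp1 : p < 1) (hq0 : 0 < q) (hq1 : q < 1) :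
    Filter.Tendsto (fun n : ℕ => tq q n / ((1 - q) ^ n * qFact q n)) Filter.atTop
      (nhds ((∏' i : ℕ, (1 - q ^ (i + 1))⁻¹) *
        ∏' x : {y : ℕ × ℕ // y.1 < y.2}, (1 - q ^ ((x : ℕ × ℕ).1 + (x : ℕ × ℕ).2))⁻¹)) ∧
    Filter.Tendsto (fun n : ℕ =>
        Apq p q n / ((1 - p) ^ n * (1 - q) ^ n * (qFact p n * qFact q n))) Filter.atTop
      (nhds (∏' x : {y : ℕ × ℕ // 0 < y.1 + y.2},
        (1 - p ^ (x : ℕ × ℕ).1 * q ^ (x : ℕ × ℕ).2)⁻¹)) := by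
  exact ⟨tendsto_tq hq0 hq1, tendsto_Apq hp0 hp1 hq0 hq1⟩

end QT
end
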